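/- arXiv:2312.10627 — 4 statements merged into one kernel-verified Lean document; each statement's English description precedes it below -/
import Mathlib

section
/- Let k ≥ 3 and N ≥ 1 be integers, let 𝕜 be a subfield of ℂ containing ζ_N := exp(2πi/N), and let G be a subgroup of SL(2,ℤ) with Γ(N) ⊆ G. Define E_k(G,𝕜) := {f ∈ span_𝕜{E_k(·, λ̄, N) : λ̄ ∈ Λ_N} : f|_k γ = f for all γ ∈ G} and E_{k,un}(G,𝕜) := {f ∈ span_𝕜{G_k(·, λ̄, N) : λ̄ ∈ Λ_N} : f|_k γ = f for all γ ∈ G}, viewed as 𝕜-submodules of the space of functions from the upper half-plane to ℂ. Then E_{k,un}(G,𝕜) = (2πi)^k · E_k(G,𝕜); i.e., f ∈ E_{k,un}(G,𝕜) if and only if f = (2πi)^k·g for some g ∈ E_k(G,𝕜). -/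
open scoped MatrixGroups
open Complex UpperHalfPlane

noncomputable section

abbrev SL2Z := Matrix.SpecialLinearGroup (Fin 2) ℤ

/-- weight `k` slash action of `γ ∈ SL(2,ℤ)` on functions `ℍ → ℂ`. -/
def slashf (k : ℤ) (γ : SL2Z) (f : ℍ → ℂ) : ℍ → ℂ :=
  fun τ => (((γ 1 0 : ℤ) : ℂ) * (τ : ℂ) + ((γ 1 1 : ℤ) : ℂ)) ^ (-k) * f (γ • τ)

def epsN (N : ℕ) : ℂ := if 3 ≤ N then 1 else 1/2

/-- normalized Eisenstein series of weight `k` on `Γ(N)` -/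
def Ek (k N : ℕ) (lam : ZMod N × ZMod N) : ℍ → ℂ :=
  fun τ => epsN N * ∑' cd : ℤ × ℤ,
    if Int.gcd cd.1 cd.2 = 1 ∧ (cd.1 : ZMod N) = lam.1 ∧ (cd.2 : ZMod N) = lam.2
    then ((cd.1 : ℂ) * (τ : ℂ) + (cd.2 : ℂ)) ^ (-(k : ℤ)) else 0

/-- unnormalized Eisenstein series of weight `k` on `Γ(N)` -/
def Gk (k N : ℕ) (lam : ZMod N × ZMod N) : ℍ → ℂ :=
  fun τ => ∑' cd : ℤ × ℤ,
    if cd ≠ (0, 0) ∧ (cd.1 : ZMod N) = lam.1 ∧ (cd.2 : ZMod N) = lam.2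
    then ((cd.1 : ℂ) * (τ : ℂ) + (cd.2 : ℂ)) ^ (-(k : ℤ)) else 0

/-- `f` is a `K`-linear combination of the functions `F lam`, `lam ∈ Λ_N`. -/
def inSpan (N : ℕ) (K : Set ℂ) (F : ZMod N × ZMod N → ℍ → ℂ) (f : ℍ → ℂ) : Prop :=
  ∃ c : ZMod N × ZMod N → ℂ, (∀ lam, c lam ∈ K) ∧
    ∀ τ : ℍ, f τ = ∑' lam : ZMod N × ZMod N,
      (if addOrderOf lam = N then c lam * F lam τ else 0)

/-- The summand `(cτ+d)^{-k}` of the Eisenstein series. -/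
def latticeTerm (k : ℕ) (τ : ℍ) (v : ℤ × ℤ) : ℂ :=
  ((v.1 : ℂ) * (τ : ℂ) + (v.2 : ℂ)) ^ (-(k : ℤ))

/-- Reduction of an integral vector modulo `N`. -/
def redMod (N : ℕ) (v : ℤ × ℤ) : ZMod N × ZMod N := ((v.1 : ZMod N), (v.2 : ZMod N))

lemma redMod_neg (N : ℕ) (v : ℤ × ℤ) : redMod N (-v) = -redMod N v := by
  simp [redMod]

lemma latticeTerm_neg (k : ℕ) (τ : ℍ) (v : ℤ × ℤ) :
    latticeTerm k τ (-v) = (-1) ^ k * latticeTerm k τ v := by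
  have h : ((-v).1 : ℂ) * (τ : ℂ) + ((-v).2 : ℂ)
      = (-1) * ((v.1 : ℂ) * (τ : ℂ) + (v.2 : ℂ)) := by
    push_cast [Prod.fst_neg, Prod.snd_neg]; ring
  rw [latticeTerm, h, mul_zpow, latticeTerm]
  congr 1
  rw [zpow_neg, zpow_natCast, ← inv_pow]
  norm_num

lemma summable_latticeTerm {k : ℕ} (hk : 3 ≤ k) (τ : ℍ) : Summable (latticeTerm k τ) := by
  have h := (EisensteinSeries.summable_norm_eisSummand (k := (k : ℤ))
    (by exact_mod_cast hk) τ).of_norm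
  exact (finTwoArrowEquiv ℤ).symm.summable_iff.mpr h

lemma summable_mul_redMod {k N : ℕ} [NeZero N] (hk : 3 ≤ k) (τ : ℍ)
    (c : ZMod N × ZMod N → ℂ) : Summable fun v ↦ c (redMod N v) * latticeTerm k τ v := by
  refine .of_norm_bounded (g := fun v ↦ (∑ l, ‖c l‖) * ‖latticeTerm k τ v‖)
    ((summable_latticeTerm hk τ).norm.mul_left _) fun v ↦ ?_
  rw [norm_mul]
  gcongr
  exact Finset.single_le_sum (f := fun l ↦ ‖c l‖) (fun _ _ ↦ norm_nonneg _) (Finset.mem_univ _)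

/-- Functions on `(ℤ/N)²` with values in `K`, supported on vectors of order `N`, and of parity
`(-1)^k`. -/
def coeffSpace (k N : ℕ) (K : Subfield ℂ) : Submodule K (ZMod N × ZMod N → ℂ) where
  carrier := {c | (∀ l, c l ∈ K) ∧ (∀ l, addOrderOf l ≠ N → c l = 0) ∧
    ∀ l, c (-l) = (-1) ^ k * c l}
  zero_mem' := by simp
  add_mem' := by
    rintro a b ⟨ha, ha', ha''⟩ ⟨hb, hb', hb''⟩
    refine ⟨fun l ↦ K.add_mem (ha l) (hb l), fun l hl ↦ ?_, fun l ↦ ?_⟩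
    · simp [ha' l hl, hb' l hl]
    · simp [ha'' l, hb'' l, mul_add]
  smul_mem' := by
    rintro r a ⟨ha, ha', ha''⟩
    refine ⟨fun l ↦ K.mul_mem r.2 (ha l), fun l hl ↦ ?_, fun l ↦ ?_⟩
    · simp [ha' l hl]
    · simp only [Pi.smul_apply, ha'' l, Subfield.smul_def, smul_eq_mul]
      ring

instance (k N : ℕ) [NeZero N] (K : Subfield ℂ) : Module.Finite K (coeffSpace k N K) := by
  let φ : (ZMod N × ZMod N → K) →ₗ[K] (ZMod N × ZMod N → ℂ) :=
    (Algebra.linearMap K ℂ).compLeft _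
  have : coeffSpace k N K ≤ LinearMap.range φ := fun c hc ↦ ⟨fun l ↦ ⟨c l, hc.1 l⟩, rfl⟩
  exact Submodule.finiteDimensional_of_le this

lemma sum_mul_tsum_eq {k N : ℕ} [NeZero N] (hk : 3 ≤ k) (τ : ℍ) (p : ℤ × ℤ → Prop)
    [DecidablePred p] (c : ZMod N × ZMod N → ℂ) :
    ∑ l, c l * ∑' v, (if p v ∧ (v.1 : ZMod N) = l.1 ∧ (v.2 : ZMod N) = l.2
      then latticeTerm k τ v else 0) =
    ∑' v, if p v then c (redMod N v) * latticeTerm k τ v else 0 := by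
  have hs (l : ZMod N × ZMod N) : Summable fun v : ℤ × ℤ ↦
      c l * (if p v ∧ (v.1 : ZMod N) = l.1 ∧ (v.2 : ZMod N) = l.2
        then latticeTerm k τ v else 0) := by
    refine Summable.mul_left _ (.of_norm_bounded (summable_latticeTerm hk τ).norm fun v ↦ ?_)
    split_ifs <;> simp
  simp_rw [← tsum_mul_left]
  rw [← Summable.tsum_finsetSum fun l _ ↦ hs l]
  congr 1 with v
  rw [Finset.sum_eq_single (redMod N v)]
  · simp [redMod]
  · intro l _ hl
    rw [if_neg, mul_zero]
    rintro ⟨-, h1, h2⟩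
    exact hl (Prod.ext h1.symm h2.symm)
  · simp

lemma inSpan_iff_exists_mem_coeffSpace {k N : ℕ} [NeZero N] (hk : 3 ≤ k) (K : Subfield ℂ)
    (p : ℤ × ℤ → Prop) [DecidablePred p] (hp : ∀ v, p (-v) ↔ p v)
    {e : ℂ} (he : e ∈ K) (he0 : e ≠ 0) (F : ZMod N × ZMod N → ℍ → ℂ)
    (hF : ∀ l τ, F l τ = e * ∑' v : ℤ × ℤ,
      if p v ∧ (v.1 : ZMod N) = l.1 ∧ (v.2 : ZMod N) = l.2 then latticeTerm k τ v else 0)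
    (f : ℍ → ℂ) :
    inSpan N (K : Set ℂ) F f ↔ ∃ c ∈ coeffSpace k N K,
      ∀ τ, f τ = ∑' v, if p v then c (redMod N v) * latticeTerm k τ v else 0 := by
  constructor
  · rintro ⟨c, hcK, hc⟩
    set a : ZMod N × ZMod N → ℂ := fun l ↦ if addOrderOf l = N then e * c l else 0 with ha
    have haK (l) : a l ∈ K := by
      simp only [ha]
      split_ifs
      exacts [K.mul_mem he (hcK l), K.zero_mem]
    have hfa (τ : ℍ) :
        f τ = ∑' v, if p v then a (redMod N v) * latticeTerm k τ v else 0 := by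
      rw [← sum_mul_tsum_eq hk, hc, tsum_fintype]
      refine Finset.sum_congr rfl fun l _ ↦ ?_
      simp only [ha, hF]
      split_ifs <;> ring
    have hone : ((-1 : ℂ) ^ k) * (-1) ^ k = 1 := by rw [← mul_pow]; simp
    refine ⟨fun l ↦ (a l + (-1) ^ k * a (-l)) / 2, ⟨fun l ↦ ?_, fun l hl ↦ ?_, fun l ↦ ?_⟩,
      fun τ ↦ ?_⟩
    · exact K.div_mem (K.add_mem (haK l) (K.mul_mem (K.pow_mem (K.neg_mem K.one_mem) k)
        (haK _))) (by exact_mod_cast natCast_mem K 2)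
    · simp [ha, hl, addOrderOf_neg]
    · simp only [neg_neg]
      linear_combination (-a (-l) / 2) * hone
    · have hs (b : ZMod N × ZMod N → ℂ) : Summable fun v ↦
          if p v then b (redMod N v) * latticeTerm k τ v else 0 := by
        refine .of_norm_bounded (summable_mul_redMod hk τ b).norm fun v ↦ ?_
        split_ifs
        · exact le_rfl
        · rw [norm_zero]
          exact norm_nonneg _
      have hneg : ∑' v, (if p v then (-1) ^ k * a (-redMod N v) * latticeTerm k τ v else 0)
          = f τ := by
        rw [hfa, ← (Equiv.neg (ℤ × ℤ)).tsum_eq]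
        refine tsum_congr fun v ↦ ?_
        simp only [Equiv.neg_apply, hp, redMod_neg, neg_neg, latticeTerm_neg]
        split_ifs
        · linear_combination (a (redMod N v) * latticeTerm k τ v) * hone
        · rfl
      have hadd := ((hs a).add (hs fun l ↦ (-1) ^ k * a (-l))).tsum_mul_left (1 / 2 : ℂ)
      rw [(hs a).tsum_add (hs fun l ↦ (-1) ^ k * a (-l)), hneg, ← hfa] at hadd
      calc f τ = 1 / 2 * (f τ + f τ) := by ring
        _ = _ := hadd.symm
        _ = _ := tsum_congr fun v ↦ by split_ifs <;> ring
  · rintro ⟨c, ⟨hcK, hc0, -⟩, hc⟩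
    refine ⟨fun l ↦ e⁻¹ * c l, fun l ↦ K.mul_mem (K.inv_mem he) (hcK l), fun τ ↦ ?_⟩
    rw [hc, ← sum_mul_tsum_eq hk, tsum_fintype]
    refine Finset.sum_congr rfl fun l _ ↦ ?_
    rw [hF]
    split_ifs with h
    · field_simp
    · rw [hc0 l h, zero_mul]

lemma summable_dilate {k N : ℕ} [NeZero N] (hk : 2 ≤ k) (c : ZMod N × ZMod N → ℂ)
    (l : ZMod N × ZMod N) : Summable fun n : ℕ ↦ 1 / (n : ℂ) ^ k * c (n • l) := by
  have h : Summable fun n : ℕ ↦ 1 / (n : ℝ) ^ k :=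
    Real.summable_one_div_nat_pow.mpr (by omega)
  refine .of_norm_bounded (h.mul_right (∑ l, ‖c l‖)) fun n ↦ ?_
  rw [norm_mul]
  gcongr
  · simp
  · exact Finset.single_le_sum (f := fun l ↦ ‖c l‖) (fun _ _ ↦ norm_nonneg _)
      (Finset.mem_univ _)

/-- The operator `c ↦ (l ↦ ∑ₙ n^{-k} c(n l))`. -/
def dilateSum {k N : ℕ} [NeZero N] (hk : 2 ≤ k) :
    (ZMod N × ZMod N → ℂ) →ₗ[ℂ] (ZMod N × ZMod N → ℂ) where
  toFun c l := ∑' n : ℕ, 1 / (n : ℂ) ^ k * c (n • l)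
  map_add' a b := by
    ext l
    simp only [Pi.add_apply, mul_add]
    exact (summable_dilate hk a l).tsum_add (summable_dilate hk b l)
  map_smul' r a := by
    ext l
    simp only [Pi.smul_apply, smul_eq_mul, RingHom.id_apply, ← tsum_mul_left]
    exact tsum_congr fun n ↦ by ring

lemma dilateSum_apply {k N : ℕ} [NeZero N] (hk : 2 ≤ k) (c : ZMod N × ZMod N → ℂ)
    (l : ZMod N × ZMod N) :
    dilateSum hk c l = ∑' n : ℕ, 1 / (n : ℂ) ^ k * c (n • l) := rfl

lemma dilateSum_injective {k N : ℕ} [NeZero N] (hk : 2 ≤ k) :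
    Function.Injective (dilateSum (N := N) hk) := by
  rw [← LinearMap.ker_eq_bot, LinearMap.ker_eq_bot']
  intro c hc
  obtain ⟨m, -, hm⟩ := Finset.exists_max_image Finset.univ (fun l ↦ ‖c l‖) Finset.univ_nonempty
  have hz : HasSum (fun n : ℕ ↦ 1 / ((n + 2 : ℕ) : ℝ) ^ 2) (Real.pi ^ 2 / 6 - 1) := by
    have := (hasSum_nat_add_iff' 2).mpr hasSum_zeta_two
    simpa [Finset.sum_range_succ] using this
  have hsplit := (summable_dilate hk c m).sum_add_tsum_nat_add 2
  rw [← dilateSum_apply hk, hc] at hsplit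
  have hcm : c m = -∑' n : ℕ, 1 / ((n + 2 : ℕ) : ℂ) ^ k * c ((n + 2) • m) := by
    simp only [Finset.sum_range_succ, Finset.sum_range_zero, Nat.cast_zero, Nat.cast_one,
      one_pow, zero_pow (show k ≠ 0 by omega), div_zero, zero_mul, zero_add, one_mul, div_one,
      one_smul, Pi.zero_apply] at hsplit
    exact eq_neg_of_add_eq_zero_left hsplit
  have hbound : ‖c m‖ ≤ (Real.pi ^ 2 / 6 - 1) * ‖c m‖ := by
    nth_rewrite 1 [hcm]
    rw [norm_neg]
    refine tsum_of_norm_bounded (hz.mul_right ‖c m‖) fun n ↦ ?_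
    rw [norm_mul]
    refine mul_le_mul ?_ (hm _ (Finset.mem_univ _)) (norm_nonneg _) (by positivity)
    rw [norm_div, norm_one, norm_pow, Complex.norm_natCast]
    refine one_div_le_one_div_of_le (by positivity) (pow_le_pow_right₀ ?_ hk)
    norm_cast; omega
  have hpi : Real.pi ^ 2 / 6 - 1 < 1 := by nlinarith [Real.pi_lt_d2, Real.pi_pos]
  have h0 : ‖c m‖ = 0 := by
    by_contra h
    have : 0 < ‖c m‖ := lt_of_le_of_ne (norm_nonneg _) (Ne.symm h)
    nlinarith
  ext l
  have := hm l (Finset.mem_univ _)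
  simp only [h0] at this
  simpa using this

open scoped Nat in
/-- A sum of `Φ(n) n^{-k}` over all integers, for `Φ` periodic with values in a field containing the
`N`-th roots of unity, is a multiple of `(2πi)^k` by an element of that field. -/
lemma exists_hasSum_periodic {k N : ℕ} [NeZero N] (hk : 2 ≤ k) {K : Subfield ℂ}
    (hK : Complex.exp (2 * Real.pi * Complex.I / (N : ℂ)) ∈ K)
    {Φ : ZMod N → ℂ} (hΦ : ∀ j, Φ j ∈ K) :
    ∃ q ∈ K, HasSum (fun n : ℤ ↦ 1 / (n : ℂ) ^ k * Φ n)
      ((2 * Real.pi * Complex.I) ^ k * q) := by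
  have hchar (j : ZMod N) : ZMod.stdAddChar j ∈ K := by
    rw [← ZMod.natCast_zmod_val j, ← Int.cast_natCast, ZMod.stdAddChar_coe]
    convert K.pow_mem hK j.val using 1
    rw [← Complex.exp_nat_mul]
    congr 1
    push_cast
    ring
  have hdft (j : ZMod N) : ZMod.dft Φ j ∈ K := by
    rw [ZMod.dft_apply]
    exact K.sum_mem fun i _ ↦ K.mul_mem (hchar _) (hΦ i)
  have hbern (j : ZMod N) : ((bernoulliFun k ((j.val : ℝ) / N) : ℝ) : ℂ) ∈ K := by
    have : bernoulliFun k ((j.val : ℝ) / N) =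
        (((Polynomial.bernoulli k).eval ((j.val : ℚ) / N) : ℚ) : ℝ) := by
      rw [bernoulliFun, show ((j.val : ℝ) / N) = algebraMap ℚ ℝ ((j.val : ℚ) / N) by
          rw [map_div₀, map_natCast, map_natCast],
        Polynomial.eval_map_apply]
      simp
    rw [this, Complex.ofReal_ratCast]
    exact SubfieldClass.ratCast_mem K _
  refine ⟨(N : ℂ)⁻¹ * ∑ j, ZMod.dft Φ j * (-1 / (k ! : ℂ) * bernoulliFun k ((j.val : ℝ) / N)),
    K.mul_mem (K.inv_mem (natCast_mem K N)) (K.sum_mem fun j _ ↦ K.mul_mem (hdft j)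
      (K.mul_mem (K.div_mem (K.neg_mem K.one_mem) (natCast_mem K _)) (hbern j))), ?_⟩
  have hsum (j : ZMod N) := hasSum_one_div_pow_mul_fourier_mul_bernoulliFun hk
    (x := (j.val : ℝ) / N) ⟨by positivity, div_le_one_of_le₀
      (by exact_mod_cast (ZMod.val_lt j).le) (by positivity)⟩
  have htot := (hasSum_sum (s := Finset.univ) fun j _ ↦
    (hsum j).mul_left (ZMod.dft Φ j)).mul_left ((N : ℂ)⁻¹)
  convert! htot using 1
  · ext n
    have hinv : Φ n = ZMod.dft.symm (ZMod.dft Φ) n := by simp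
    rw [hinv, ZMod.invDFT_apply, smul_eq_mul, mul_left_comm, Finset.mul_sum]
    congr 1
    refine Finset.sum_congr rfl fun j _ ↦ ?_
    have : ZMod.stdAddChar (j * (n : ZMod N)) =
        fourier n (((j.val : ℝ) / N : ℝ) : UnitAddCircle) := by
      rw [fourier_coe_apply]
      have hj : j * (n : ZMod N) = ((j.val * n : ℤ) : ZMod N) := by push_cast; simp
      rw [hj, ZMod.stdAddChar_coe]
      congr 1
      push_cast
      ring
    rw [smul_eq_mul, this]
    ring
  · rw [mul_left_comm, Finset.mul_sum]
    congr 1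
    refine Finset.sum_congr rfl fun j _ ↦ ?_
    ring

lemma addOrderOf_dvd_level {N : ℕ} (l : ZMod N × ZMod N) : addOrderOf l ∣ N := by
  rw [addOrderOf_dvd_iff_nsmul_eq_zero]
  ext <;> simp

lemma dilateSum_eq_of_mem {k N : ℕ} [NeZero N] (hk : 2 ≤ k) {K : Subfield ℂ}
    (hK : Complex.exp (2 * Real.pi * Complex.I / (N : ℂ)) ∈ K)
    {c : ZMod N × ZMod N → ℂ} (hc : c ∈ coeffSpace k N K) (l : ZMod N × ZMod N) :
    ∃ q ∈ K, dilateSum hk c l = (2 * Real.pi * Complex.I) ^ k * q := by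
  obtain ⟨hcK, -, hpar⟩ := hc
  obtain ⟨q, hq, hs⟩ := exists_hasSum_periodic hk hK (Φ := fun j ↦ c (j * l.1, j * l.2))
    fun j ↦ hcK _
  have hn (n : ℕ) : ((n : ZMod N) * l.1, (n : ZMod N) * l.2) = n • l := by
    ext <;> simp
  have hone : ((-1 : ℂ) ^ k) * (-1) ^ k = 1 := by rw [← mul_pow]; simp
  have h2 := hs.nat_add_neg.tsum_eq
  have hterm (n : ℕ) : 1 / (((n : ℤ) : ℂ)) ^ k *
        c ((((n : ℤ) : ZMod N)) * l.1, ((n : ℤ) : ZMod N) * l.2) +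
      1 / ((((-(n : ℤ)) : ℤ) : ℂ)) ^ k *
        c (((-(n : ℤ) : ℤ) : ZMod N) * l.1, ((-(n : ℤ) : ℤ) : ZMod N) * l.2) =
      2 * (1 / (n : ℂ) ^ k * c (n • l)) := by
    have hneg : (((-(n : ℤ) : ℤ) : ZMod N) * l.1, ((-(n : ℤ) : ℤ) : ZMod N) * l.2)
        = -(n • l) := by
      rw [← hn]; ext <;> simp
    rw [hneg, hpar, Int.cast_natCast, Int.cast_natCast, hn, Int.cast_neg, Int.cast_natCast,
      neg_pow, one_div, one_div, mul_inv, ← inv_pow (-1 : ℂ), show (-1 : ℂ)⁻¹ = -1 by norm_num]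
    linear_combination (((n : ℂ) ^ k)⁻¹ * c (n • l)) * hone
  simp only [hterm] at h2
  rw [tsum_mul_left, ← dilateSum_apply hk] at h2
  refine ⟨q / 2, K.div_mem hq (by exact_mod_cast natCast_mem K 2), ?_⟩
  simp only [Int.cast_zero, zero_pow (show k ≠ 0 by omega), div_zero, zero_mul, add_zero] at h2
  linear_combination h2 / 2

lemma two_pi_I_pow_ne_zero (k : ℕ) : (2 * Real.pi * Complex.I : ℂ) ^ k ≠ 0 :=
  pow_ne_zero _ Complex.two_pi_I_ne_zero

lemma smul_dilateSum_mem {k N : ℕ} [NeZero N] (hk : 2 ≤ k) {K : Subfield ℂ}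
    (hK : Complex.exp (2 * Real.pi * Complex.I / (N : ℂ)) ∈ K)
    {c : ZMod N × ZMod N → ℂ} (hc : c ∈ coeffSpace k N K) :
    ((2 * Real.pi * Complex.I : ℂ) ^ k)⁻¹ • dilateSum hk c ∈ coeffSpace k N K := by
  refine ⟨fun l ↦ ?_, fun l hl ↦ ?_, fun l ↦ ?_⟩
  · obtain ⟨q, hq, h⟩ := dilateSum_eq_of_mem hk hK hc l
    rw [Pi.smul_apply, h, smul_eq_mul, inv_mul_cancel_left₀ (two_pi_I_pow_ne_zero k)]
    exact hq
  · have h (n : ℕ) : c (n • l) = 0 := hc.2.1 _ fun h ↦ hl <|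
      Nat.dvd_antisymm (addOrderOf_dvd_level l) (h.symm.dvd.trans (addOrderOf_smul_dvd n))
    simp only [Pi.smul_apply, dilateSum_apply, h, mul_zero, tsum_zero, smul_zero]
  · simp only [Pi.smul_apply, smul_eq_mul, dilateSum_apply, smul_neg, hc.2.2]
    simp_rw [mul_left_comm _ ((-1 : ℂ) ^ k), tsum_mul_left]
    ring

lemma exists_smul_dilateSum_eq {k N : ℕ} [NeZero N] (hk : 2 ≤ k) {K : Subfield ℂ}
    (hK : Complex.exp (2 * Real.pi * Complex.I / (N : ℂ)) ∈ K)
    {c : ZMod N × ZMod N → ℂ} (hc : c ∈ coeffSpace k N K) :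
    ∃ b ∈ coeffSpace k N K, ((2 * Real.pi * Complex.I : ℂ) ^ k)⁻¹ • dilateSum hk b = c := by
  let T : (ZMod N × ZMod N → ℂ) →ₗ[K] (ZMod N × ZMod N → ℂ) :=
    (((2 * Real.pi * Complex.I : ℂ) ^ k)⁻¹ • dilateSum hk).restrictScalars K
  have hT : ∀ b ∈ coeffSpace k N K, T b ∈ coeffSpace k N K :=
    fun b hb ↦ smul_dilateSum_mem hk hK hb
  have hinj : Function.Injective (T.restrict hT) := by
    intro a b hab
    have h : T a = T b := congrArg Subtype.val hab
    exact Subtype.ext (dilateSum_injective hk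
      (smul_right_injective _ (inv_ne_zero (two_pi_I_pow_ne_zero k)) h))
  obtain ⟨b, hb⟩ := LinearMap.injective_iff_surjective.mp hinj ⟨c, hc⟩
  exact ⟨b, b.2, congrArg Subtype.val hb⟩

/-- Sorting lattice vectors by their content. -/
lemma tsum_lattice_eq_tsum_coprime {k N : ℕ} [NeZero N] (hk : 3 ≤ k) (τ : ℍ)
    (c : ZMod N × ZMod N → ℂ) :
    ∑' v, (if v ≠ (0, 0) then c (redMod N v) * latticeTerm k τ v else 0) =
    ∑' v : ℤ × ℤ, if Int.gcd v.1 v.2 = 1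
      then dilateSum (show 2 ≤ k by omega) c (redMod N v) * latticeTerm k τ v else 0 := by
  have hk0 : k ≠ 0 := by omega
  have hzero (v : ℤ × ℤ) : (if v ≠ (0, 0) then c (redMod N v) * latticeTerm k τ v else 0) =
      c (redMod N v) * latticeTerm k τ v := by
    split_ifs with h
    · rfl
    · obtain rfl := not_not.mp h
      simp [latticeTerm, hk0]
  simp_rw [hzero]
  let P : Set (ℤ × ℤ) := {v | Int.gcd v.1 v.2 = 1}
  let e : P × ℕ+ → ℤ × ℤ := fun p ↦ (p.2 * p.1.1.1, p.2 * p.1.1.2)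
  have hgcd (p : P × ℕ+) : Int.gcd (e p).1 (e p).2 = p.2 := by
    have := p.1.2
    simp only [P, Set.mem_ofPred_eq] at this
    simp [e, Int.gcd_mul_left, this]
  have he : Function.Injective e := by
    intro p q hpq
    have h2 : p.2 = q.2 := PNat.coe_injective (by rw [← hgcd p, ← hgcd q, hpq])
    have hne : ((q.2 : ℕ) : ℤ) ≠ 0 := by exact_mod_cast q.2.ne_zero
    have h3 := congrArg Prod.fst hpq
    have h4 := congrArg Prod.snd hpq
    simp only [e, h2] at h3 h4
    exact Prod.ext (Subtype.ext (Prod.ext (mul_left_cancel₀ hne h3)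
      (mul_left_cancel₀ hne h4))) h2
  have hterm (p : P × ℕ+) : c (redMod N (e p)) * latticeTerm k τ (e p) =
      1 / ((p.2 : ℕ) : ℂ) ^ k * c ((p.2 : ℕ) • redMod N p.1) * latticeTerm k τ p.1 := by
    have h1 : redMod N (e p) = (p.2 : ℕ) • redMod N p.1 := by
      ext <;> simp [redMod, e]
    have h2 : latticeTerm k τ (e p) = 1 / ((p.2 : ℕ) : ℂ) ^ k * latticeTerm k τ p.1 := by
      have : ((e p).1 : ℂ) * (τ : ℂ) + ((e p).2 : ℂ) =
          ((p.2 : ℕ) : ℂ) * ((p.1.1.1 : ℂ) * (τ : ℂ) + (p.1.1.2 : ℂ)) := by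
        simp only [e]; push_cast; ring
      rw [latticeTerm, this, mul_zpow, zpow_neg, zpow_natCast, one_div, latticeTerm]
    rw [h1, h2]
    ring
  have hsupp : Function.support (fun v ↦ c (redMod N v) * latticeTerm k τ v) ⊆ Set.range e := by
    intro v hv
    have hv0 : 0 < Int.gcd v.1 v.2 := by
      rw [Int.gcd_pos_iff]
      by_contra! h
      obtain rfl : v = (0, 0) := Prod.ext h.1 h.2
      simp [latticeTerm, hk0] at hv
    obtain ⟨a, b, hab, h1, h2⟩ := Int.exists_gcd_one hv0
    refine ⟨(⟨(a, b), hab⟩, ⟨_, hv0⟩), Prod.ext ?_ ?_⟩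
    · simpa [e, mul_comm] using h1.symm
    · simpa [e, mul_comm] using h2.symm
  have hsum : Summable fun p ↦ c (redMod N (e p)) * latticeTerm k τ (e p) :=
    (summable_mul_redMod hk τ c).comp_injective he
  rw [← he.tsum_eq hsupp, hsum.tsum_prod]
  have hind : (fun v : ℤ × ℤ ↦ if Int.gcd v.1 v.2 = 1
      then dilateSum (show 2 ≤ k by omega) c (redMod N v) * latticeTerm k τ v else 0) =
      P.indicator fun v ↦ dilateSum (show 2 ≤ k by omega) c (redMod N v) *
        latticeTerm k τ v := by
    ext v
    simp [Set.indicator_apply, P]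
  rw [hind, ← tsum_subtype P]
  refine tsum_congr fun w ↦ ?_
  simp only [hterm, tsum_mul_right]
  congr 1
  rw [dilateSum_apply]
  refine PNat.coe_injective.tsum_eq
    (f := fun n : ℕ ↦ 1 / (n : ℂ) ^ k * c (n • redMod N w)) fun n hn ↦ ?_
  refine ⟨⟨n, Nat.pos_of_ne_zero ?_⟩, rfl⟩
  rintro rfl
  simp [hk0] at hn

lemma inSpan_Gk_iff {k N : ℕ} [NeZero N] (hk : 3 ≤ k) (K : Subfield ℂ) (f : ℍ → ℂ) :
    inSpan N (K : Set ℂ) (Gk k N) f ↔ ∃ c ∈ coeffSpace k N K, ∀ τ, f τ =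
      ∑' v, if v ≠ (0, 0) then c (redMod N v) * latticeTerm k τ v else 0 := by
  refine inSpan_iff_exists_mem_coeffSpace hk K (fun v ↦ v ≠ (0, 0)) (fun v ↦ ?_) K.one_mem
    one_ne_zero _ (fun l τ ↦ ?_) f
  · rw [← Prod.zero_eq_mk, neg_ne_zero]
  · rw [one_mul]; rfl

lemma inSpan_Ek_iff {k N : ℕ} [NeZero N] (hk : 3 ≤ k) (K : Subfield ℂ) (f : ℍ → ℂ) :
    inSpan N (K : Set ℂ) (Ek k N) f ↔ ∃ c ∈ coeffSpace k N K, ∀ τ, f τ =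
      ∑' v : ℤ × ℤ, if Int.gcd v.1 v.2 = 1
        then c (redMod N v) * latticeTerm k τ v else 0 := by
  refine inSpan_iff_exists_mem_coeffSpace hk K (fun v ↦ Int.gcd v.1 v.2 = 1) (fun v ↦ ?_)
    (e := epsN N) ?_ ?_ _ (fun l τ ↦ rfl) f
  · simp
  · rw [epsN]
    split_ifs
    exacts [K.one_mem, K.div_mem K.one_mem (by exact_mod_cast natCast_mem K 2)]
  · rw [epsN]
    split_ifs <;> norm_num

lemma inSpan_Gk_iff_exists_inSpan_Ek {k N : ℕ} [NeZero N] (hk : 3 ≤ k) (K : Subfield ℂ)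
    (hK : Complex.exp (2 * Real.pi * Complex.I / (N : ℂ)) ∈ K) (g : ℍ → ℂ) :
    inSpan N (K : Set ℂ) (Gk k N) (fun τ ↦ (2 * Real.pi * Complex.I) ^ k * g τ) ↔
      inSpan N (K : Set ℂ) (Ek k N) g := by
  have hk2 : 2 ≤ k := by omega
  have key (c : ZMod N × ZMod N → ℂ) (τ : ℍ) :
      ∑' v, (if v ≠ (0, 0) then c (redMod N v) * latticeTerm k τ v else 0) =
      (2 * Real.pi * Complex.I) ^ k * ∑' v : ℤ × ℤ, if Int.gcd v.1 v.2 = 1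
        then (((2 * Real.pi * Complex.I : ℂ) ^ k)⁻¹ • dilateSum hk2 c) (redMod N v) *
          latticeTerm k τ v else 0 := by
    rw [tsum_lattice_eq_tsum_coprime hk, ← tsum_mul_left]
    refine tsum_congr fun v ↦ ?_
    split_ifs
    · rw [Pi.smul_apply, smul_eq_mul, mul_assoc (_ ^ k)⁻¹,
        mul_inv_cancel_left₀ (two_pi_I_pow_ne_zero k)]
    · simp
  rw [inSpan_Gk_iff hk, inSpan_Ek_iff hk]
  constructor
  · rintro ⟨c, hc, h⟩
    refine ⟨_, smul_dilateSum_mem hk2 hK hc, fun τ ↦ ?_⟩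
    exact mul_left_cancel₀ (two_pi_I_pow_ne_zero k) ((h τ).trans (key c τ))
  · rintro ⟨c, hc, h⟩
    obtain ⟨b, hb, rfl⟩ := exists_smul_dilateSum_eq hk2 hK hc
    exact ⟨b, hb, fun τ ↦ by rw [key, ← h]⟩

lemma slashf_const_mul_eq_iff {a : ℂ} (ha : a ≠ 0) (k : ℤ) (γ : SL2Z) (g : ℍ → ℂ) :
    slashf k γ (fun τ ↦ a * g τ) = (fun τ ↦ a * g τ) ↔ slashf k γ g = g := by
  simp only [funext_iff, slashf, mul_left_comm _ a, mul_right_inj' ha]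

/-- For `k ≥ 3`, a subfield `𝕜 ⊆ ℂ` containing `ζ_N`, and `G ⊇ Γ(N)`,
the space of `G`-invariant unnormalized Eisenstein series with coefficients in `𝕜`
equals `(2πi)^k` times the corresponding normalized space:
`E_{k,un}(G,𝕜) = (2πi)^k · E_k(G,𝕜)`. -/
theorem unnormalized_eq_twoPiI_pow_smul (k N : ℕ) (hk : 3 ≤ k) (hN : 1 ≤ N)
    (K : Subfield ℂ) (hK : Complex.exp (2 * Real.pi * Complex.I / (N : ℂ)) ∈ K)
    (G : Subgroup SL2Z) (hG : CongruenceSubgroup.Gamma N ≤ G) :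
    ∀ f : ℍ → ℂ,
      (inSpan N (K : Set ℂ) (Gk k N) f ∧ ∀ γ ∈ G, slashf (k : ℤ) γ f = f) ↔
      ∃ g : ℍ → ℂ,
        (inSpan N (K : Set ℂ) (Ek k N) g ∧ ∀ γ ∈ G, slashf (k : ℤ) γ g = g) ∧
        f = fun τ => (2 * Real.pi * Complex.I) ^ k * g τ := by
  have : NeZero N := ⟨by omega⟩
  have h0 := two_pi_I_pow_ne_zero k
  have key (g : ℍ → ℂ) :
      (inSpan N (K : Set ℂ) (Gk k N) (fun τ ↦ (2 * Real.pi * Complex.I) ^ k * g τ) ∧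
        ∀ γ ∈ G, slashf (k : ℤ) γ (fun τ ↦ (2 * Real.pi * Complex.I) ^ k * g τ) =
          fun τ ↦ (2 * Real.pi * Complex.I) ^ k * g τ) ↔
      (inSpan N (K : Set ℂ) (Ek k N) g ∧ ∀ γ ∈ G, slashf (k : ℤ) γ g = g) := by
    simp only [inSpan_Gk_iff_exists_inSpan_Ek hk K hK, slashf_const_mul_eq_iff h0]
  intro f
  constructor
  · intro hf
    have hfg : f = fun τ ↦ (2 * Real.pi * Complex.I) ^ k *
        (((2 * Real.pi * Complex.I) ^ k)⁻¹ * f τ) :=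
      funext fun τ ↦ (mul_inv_cancel_left₀ h0 _).symm
    rw [hfg] at hf
    exact ⟨_, (key _).mp hf, hfg⟩
  · rintro ⟨g, hg, rfl⟩
    exact (key g).mpr hg
end
end

section
/- Let k ≥ 3 and N ≥ 1 be integers and let 𝕜 be a subfield of ℂ containing ζ_N := exp(2πi/N). Then every function f in the 𝕜-span of {E_k(·, λ̄, N) : λ̄ ∈ Λ_N} admits a Fourier expansion f(τ) = Σ_{j=0}^{∞} A_j · e(jτ/N), valid for all τ in the upper half-plane, whose coefficients A_j all lie in 𝕜. In particular, each normalized Eisenstein series E_k(·, λ̄, N) has all of its Fourier coefficients in the cyclotomic field ℚ(ζ_N). -/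
open Complex UpperHalfPlane

noncomputable section

/-- `f` is a `K`-linear combination of the `E_k(·, λ̄, N)`, `λ̄ ∈ Λ_N`. -/
def inSpanE (k N : ℕ) (K : Set ℂ) (f : ℍ → ℂ) : Prop :=
  ∃ c : ZMod N × ZMod N → ℂ, (∀ lam, c lam ∈ K) ∧
    ∀ τ : ℍ, f τ = ∑' lam : ZMod N × ZMod N,
      (if addOrderOf lam = N then c lam * Ek k N lam τ else 0)

/-- Convolution by a real weight dominated by its value at `1` is injective. -/
theorem eq_zero_of_conv_eq_zero {U : Type*} [CommGroup U] [Fintype U] {z : U → ℝ}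
    (hz : ∀ u, 0 ≤ z u) (hz1 : ∑ u, z u < 2 * z 1) {D : U → ℂ}
    (hD : ∀ v, ∑ u, (z u : ℂ) * D (u⁻¹ * v) = 0) : D = 0 := by
  classical
  obtain ⟨v, -, hv⟩ := Finset.exists_max_image Finset.univ (fun v => ‖D v‖) ⟨1, Finset.mem_univ _⟩
  have hmax : ∀ w, ‖D w‖ ≤ ‖D v‖ := fun w => hv w (Finset.mem_univ w)
  have h1 := hD v
  rw [← Finset.add_sum_erase _ _ (Finset.mem_univ (1 : U))] at h1 hz1
  simp only [inv_one, one_mul] at h1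
  have h2 : z 1 * ‖D v‖ ≤ (∑ u ∈ Finset.univ.erase 1, z u) * ‖D v‖ := by
    calc z 1 * ‖D v‖ = ‖(z 1 : ℂ) * D v‖ := by simp [abs_of_nonneg (hz 1)]
      _ = ‖∑ u ∈ Finset.univ.erase 1, (z u : ℂ) * D (u⁻¹ * v)‖ := by
          rw [eq_neg_of_add_eq_zero_left h1, norm_neg]
      _ ≤ ∑ u ∈ Finset.univ.erase 1, z u * ‖D v‖ := by
          refine norm_sum_le_of_le _ fun u _ => ?_
          rw [norm_mul, norm_real, Real.norm_of_nonneg (hz u)]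
          exact mul_le_mul_of_nonneg_left (hmax _) (hz u)
      _ = _ := by rw [Finset.sum_mul]
  have h3 : ‖D v‖ = 0 := by
    by_contra h
    have : 0 < ‖D v‖ := lt_of_le_of_ne (norm_nonneg _) (Ne.symm h)
    nlinarith
  funext w
  exact norm_le_zero_iff.mp ((hmax w).trans h3.le)

/-- If the `s`-symmetrized weight and the right-hand side of a convolution equation are rational
over `K` up to a common factor `C`, then so is the solution. -/
theorem mem_of_conv_eq {U : Type*} [CommGroup U] [Fintype U] {z : U → ℝ}
    (hz : ∀ u, 0 ≤ z u) (hz1 : ∑ u, z u < 2 * z 1) (K : Subfield ℂ) {s : U} (hs : s * s = 1)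
    {σ : ℂ} (hσK : σ ∈ K) {C : ℂ} (hC : C ≠ 0)
    (hzK : ∀ u, ((z u : ℂ) + σ * z (s * u)) / C ∈ K) {g a : U → ℂ} (hgK : ∀ v, g v / C ∈ K)
    (hg : ∀ v, g (s * v) = σ * g v) (ha : ∀ v, ∑ u, (z u : ℂ) * a (u⁻¹ * v) = g v) (v : U) :
    a v ∈ K := by
  have hsym : ∀ b : U → ℂ, (∀ v, b (s * v) = σ * b v) → ∀ v,
      ∑ u, ((z u : ℂ) + σ * z (s * u)) * b (u⁻¹ * v)
        = 2 * ∑ u, (z u : ℂ) * b (u⁻¹ * v) := by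
    intro b hb v
    have : ∑ u, (σ * z (s * u)) * b (u⁻¹ * v) = ∑ u, (z u : ℂ) * b (u⁻¹ * v) := by
      rw [← Equiv.sum_comp (Equiv.mulLeft s) (fun u => (z u : ℂ) * b (u⁻¹ * v))]
      refine Finset.sum_congr rfl fun u _ => ?_
      have h : (s * u)⁻¹ * v = s * (u⁻¹ * v) := by
        rw [mul_inv, inv_eq_of_mul_eq_one_left hs, mul_assoc]
      rw [Equiv.coe_mulLeft, h, hb]
      ring
    simp only [add_mul, Finset.sum_add_distrib, two_mul]
    rw [this]
  have hasym : ∀ v, a (s * v) = σ * a v := by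
    have := eq_zero_of_conv_eq_zero hz hz1 (D := fun v => a (s * v) - σ * a v) fun v => by
      have h : ∀ u, s * (u⁻¹ * v) = u⁻¹ * (s * v) := fun u => mul_left_comm _ _ _
      simp only [mul_sub, Finset.sum_sub_distrib, h, ha, hg, mul_left_comm _ σ, ← Finset.mul_sum,
        sub_self]
    exact fun v => sub_eq_zero.mp (congrFun this v)
  obtain ⟨φ, hφ⟩ := (Algebra.linearMap K ℂ).exists_leftInverse_of_injective
    (LinearMap.ker_eq_bot.mpr (algebraMap K ℂ).injective)
  have hφK : ∀ x ∈ K, ∀ y, (φ (x * y) : ℂ) = x * φ y := fun x hx y => by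
    have := φ.map_smul ⟨x, hx⟩ y
    rw [Subfield.smul_def, smul_eq_mul] at this
    simp [this]
  have hφ1 : ∀ x ∈ K, (φ x : ℂ) = x := fun x hx => by
    have := LinearMap.congr_fun hφ ⟨x, hx⟩
    exact congrArg Subtype.val this
  have := eq_zero_of_conv_eq_zero hz hz1 (D := fun v => a v - φ (a v)) fun v => by
    have h1 : ∀ b : U → ℂ, (∀ v, b (s * v) = σ * b v) → ∀ v,
        ∑ u, ((z u : ℂ) + σ * z (s * u)) / C * b (u⁻¹ * v)
          = 2 / C * ∑ u, (z u : ℂ) * b (u⁻¹ * v) := fun b hb v => by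
      rw [div_mul_eq_mul_div, ← hsym b hb v, Finset.sum_div]
      exact Finset.sum_congr rfl fun u _ => by ring
    have h2 := h1 (fun v => a v - φ (a v)) (fun v => by rw [hasym, hφK σ hσK]; ring) v
    have h3 : ∑ u, ((z u : ℂ) + σ * z (s * u)) / C * (a (u⁻¹ * v) - φ (a (u⁻¹ * v))) = 0 := by
      simp only [mul_sub, Finset.sum_sub_distrib, ← hφK _ (hzK _)]
      rw [h1 a hasym, ha, ← AddSubmonoidClass.coe_finsetSum, ← map_sum, h1 a hasym, ha, hφ1, sub_self]
      have : 2 / C * g v = 2 * (g v / C) := by ring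
      rw [this]
      exact mul_mem (ofNat_mem K 2) (hgK v)
    rw [h3] at h2
    exact (mul_eq_zero.mp h2.symm).resolve_left (div_ne_zero two_ne_zero hC)
  have h4 := sub_eq_zero.mp (congrFun this v)
  rw [h4]
  exact (φ (a v)).2

/-- The partial zeta value `∑_{n ≥ 1, n ≡ u mod N} n^{-k}`. -/
def partialZeta (k N : ℕ) (u : ZMod N) : ℝ :=
  ∑' n : ℕ, if (n : ZMod N) = u then 1 / (n : ℝ) ^ k else 0

theorem summable_partialZeta {k : ℕ} (hk : 3 ≤ k) {N : ℕ} (u : ZMod N) :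
    Summable fun n : ℕ => if (n : ZMod N) = u then 1 / (n : ℝ) ^ k else 0 := by
  refine Summable.of_nonneg_of_le (fun n => ?_) (fun n => ?_)
    (Real.summable_one_div_nat_pow.mpr (by omega : 1 < k))
  · split_ifs <;> positivity
  · split_ifs
    · exact le_rfl
    · positivity

theorem partialZeta_nonneg (k : ℕ) {N : ℕ} (u : ZMod N) : 0 ≤ partialZeta k N u :=
  tsum_nonneg fun n => by split_ifs <;> positivity

theorem one_le_partialZeta_one {k : ℕ} (hk : 3 ≤ k) (N : ℕ) : 1 ≤ partialZeta k N 1 := by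
  have := (summable_partialZeta hk (1 : ZMod N)).le_tsum 1 fun n _ => by split_ifs <;> positivity
  simpa [partialZeta] using this

theorem sum_partialZeta_lt {k : ℕ} (hk : 3 ≤ k) (N : ℕ) [NeZero N] :
    ∑ u : (ZMod N)ˣ, partialZeta k N u < 2 := by
  have h0 : ∑ u : (ZMod N)ˣ, partialZeta k N u ≤ ∑ u : ZMod N, partialZeta k N u := by
    rw [← Finset.sum_image (f := partialZeta k N) (s := Finset.univ)
      (g := ((↑) : (ZMod N)ˣ → ZMod N)) fun _ _ _ _ h => Units.ext h]
    exact Finset.sum_le_sum_of_subset_of_nonneg (Finset.subset_univ _)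
      fun u _ _ => partialZeta_nonneg k u
  have h1 : ∑ u : ZMod N, partialZeta k N u = ∑' n : ℕ, 1 / (n : ℝ) ^ k := by
    simp only [partialZeta]
    rw [← Summable.tsum_finsetSum fun u _ => summable_partialZeta hk u]
    simp
  have h2 : ∑' n : ℕ, 1 / (n : ℝ) ^ k ≤ Real.pi ^ 2 / 6 := by
    rw [← hasSum_zeta_two.tsum_eq]
    refine Summable.tsum_le_tsum (fun n => ?_)
      (Real.summable_one_div_nat_pow.mpr (by omega : 1 < k)) hasSum_zeta_two.summable
    rcases Nat.eq_zero_or_pos n with rfl | hn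
    · simp [show k ≠ 0 by omega]
    · have : (1 : ℝ) ≤ n := by exact_mod_cast hn
      exact one_div_le_one_div_of_le (by positivity) (pow_le_pow_right₀ this (by omega))
  nlinarith [Real.pi_lt_d2, Real.pi_pos]

theorem stdAddChar_mem {N : ℕ} [NeZero N] {K : Subfield ℂ}
    (hK : Complex.exp (2 * Real.pi * Complex.I / (N : ℂ)) ∈ K) (a : ZMod N) :
    ZMod.stdAddChar a ∈ K := by
  have h := ZMod.stdAddChar_coe (N := N) a.val
  rw [Int.cast_natCast, ZMod.natCast_zmod_val] at h
  rw [h]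
  convert pow_mem hK a.val using 1
  rw [← Complex.exp_nat_mul]
  push_cast
  ring_nf

theorem bernoulliFun_ratCast_mem (K : Subfield ℂ) (k : ℕ) (q : ℚ) :
    (bernoulliFun k q : ℂ) ∈ K := by
  rw [bernoulliFun, Polynomial.eval_map_algebraMap, ← eq_ratCast (algebraMap ℚ ℝ) q,
    Polynomial.aeval_algebraMap_apply]
  simp

theorem hasSum_int_residue {k : ℕ} (hk : 3 ≤ k) {N : ℕ} [NeZero N] (u : ZMod N) :
    HasSum (fun n : ℤ => if (n : ZMod N) = u then 1 / (n : ℂ) ^ k else 0)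
      ((2 * Real.pi * Complex.I) ^ k * ((N : ℂ)⁻¹ * ∑ a : ZMod N, ZMod.stdAddChar (-(u * a)) *
        (-(bernoulliFun k ((a.val : ℚ) / N : ℚ) / k.factorial)))) := by
  have hN : (N : ℝ) ≠ 0 := NeZero.ne _
  have h : ∀ a : ZMod N, HasSum
      (fun n : ℤ => 1 / (n : ℂ) ^ k * ZMod.stdAddChar ((n : ZMod N) * a))
      ((2 * Real.pi * Complex.I) ^ k * -(bernoulliFun k ((a.val : ℚ) / N : ℚ) / k.factorial)) := by
    intro a
    convert hasSum_one_div_pow_mul_fourier_mul_bernoulliFun (k := k) (by omega)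
      (x := ((a.val : ℚ) / N : ℚ)) ⟨by positivity, ?_⟩ using 1
    · funext n
      rw [fourier_coe_apply]
      have := ZMod.stdAddChar_coe (N := N) (n * a.val)
      push_cast at this
      rw [ZMod.natCast_zmod_val] at this
      rw [this]
      push_cast
      congr 2
      ring
    · ring
    · push_cast
      rw [div_le_one (by positivity)]
      exact_mod_cast a.val_lt.le
  have h2 := (hasSum_sum fun a (_ : a ∈ Finset.univ) =>
    (h a).mul_left (ZMod.stdAddChar (-(u * a)))).mul_left ((N : ℂ)⁻¹)
  convert! h2 using 1
  · funext n
    have h3 : ∀ a : ZMod N, ZMod.stdAddChar (-(u * a)) *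
        (1 / (n : ℂ) ^ k * ZMod.stdAddChar ((n : ZMod N) * a))
          = 1 / (n : ℂ) ^ k * ZMod.stdAddChar (a * ((n : ZMod N) - u)) := fun a => by
      rw [mul_left_comm, ← AddChar.map_add_eq_mul]
      ring_nf
    simp only [h3, ← Finset.mul_sum]
    rw [AddChar.sum_mulShift _ (ZMod.isPrimitive_stdAddChar N), ZMod.card]
    simp only [sub_eq_zero]
    split_ifs
    · have hN' : (N : ℂ) ≠ 0 := NeZero.ne _
      rw [mul_comm (1 / _), inv_mul_cancel_left₀ hN']
    · simp
  · simp only [Finset.mul_sum]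
    exact Finset.sum_congr rfl fun a _ => by ring

theorem partialZeta_symm_div_mem {k : ℕ} (hk : 3 ≤ k) {N : ℕ} [NeZero N] {K : Subfield ℂ}
    (hK : Complex.exp (2 * Real.pi * Complex.I / (N : ℂ)) ∈ K) (u : ZMod N) :
    ((partialZeta k N u : ℂ) + (-1) ^ k * partialZeta k N (-u)) / (2 * Real.pi * Complex.I) ^ k ∈ K := by
  have hs : ∀ u : ZMod N, HasSum (fun n : ℕ => if (n : ZMod N) = u then 1 / (n : ℂ) ^ k else 0)
      (partialZeta k N u) := fun u => by
    have := Complex.hasSum_ofReal.mpr (summable_partialZeta hk u).hasSum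
    simp only [apply_ite Complex.ofReal] at this
    simpa [partialZeta] using this
  have h1 := (hs u).add ((hs (-u)).mul_left ((-1) ^ k))
  have h2 := (hasSum_int_residue hk u).nat_add_neg
  have h3 : ∀ n : ℕ, (if (n : ZMod N) = u then 1 / (n : ℂ) ^ k else 0) +
      (-1) ^ k * (if (n : ZMod N) = -u then 1 / (n : ℂ) ^ k else 0)
      = (if (((n : ℤ) : ℤ) : ZMod N) = u then 1 / ((n : ℤ) : ℂ) ^ k else 0) +
        (if ((-(n : ℤ) : ℤ) : ZMod N) = u then 1 / ((-(n : ℤ) : ℤ) : ℂ) ^ k else 0) := by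
    intro n
    have h4 : (1 : ℂ) / (-(n : ℂ)) ^ k = (-1) ^ k * (1 / (n : ℂ) ^ k) := by
      rw [neg_pow, one_div, mul_inv, ← inv_pow]
      norm_num
    push_cast
    rw [h4]
    simp only [neg_eq_iff_eq_neg, mul_ite, mul_zero]
  simp only [← h3] at h2
  rw [h1.unique h2]
  have h5 : (2 * Real.pi * Complex.I : ℂ) ^ k ≠ 0 := pow_ne_zero _ Complex.two_pi_I_ne_zero
  simp only [Int.cast_zero, ne_eq, show k ≠ 0 by omega, not_false_eq_true, zero_pow, div_zero,
    ite_self, add_zero]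
  rw [mul_div_cancel_left₀ _ h5]
  refine mul_mem (inv_mem (natCast_mem K N)) (sum_mem fun a _ => mul_mem (stdAddChar_mem hK _) ?_)
  exact neg_mem (div_mem (bernoulliFun_ratCast_mem K k _) (natCast_mem K _))

/-- The sum of `(cτ + d)^{-k}` over the pairs `(c, d) ≡ lam mod N` with `c > 0` satisfying `P`. -/
def posSum (P : ℤ × ℤ → Prop) [DecidablePred P] (k N : ℕ) (lam : ZMod N × ZMod N) (τ : ℍ) : ℂ :=
  ∑' cd : ℤ × ℤ, if 0 < cd.1 ∧ P cd ∧ (cd.1 : ZMod N) = lam.1 ∧ (cd.2 : ZMod N) = lam.2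
    then ((cd.1 : ℂ) * (τ : ℂ) + (cd.2 : ℂ)) ^ (-(k : ℤ)) else 0

theorem summable_norm_ite_eis {k : ℕ} (hk : 3 ≤ k) (Q : ℤ × ℤ → Prop) [DecidablePred Q] (τ : ℍ) :
    Summable fun cd : ℤ × ℤ =>
      ‖if Q cd then ((cd.1 : ℂ) * (τ : ℂ) + (cd.2 : ℂ)) ^ (-(k : ℤ)) else 0‖ := by
  have h : Summable fun cd : ℤ × ℤ => ‖((cd.1 : ℂ) * (τ : ℂ) + (cd.2 : ℂ)) ^ (-(k : ℤ))‖ :=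
    (_root_.summable_prod_eisSummand hk τ).norm.congr fun cd => by
      simp [EisensteinSeries.eisSummand]
  refine h.of_nonneg_of_le (fun _ => norm_nonneg _) fun cd => ?_
  split_ifs
  · exact le_rfl
  · simp

/-- The Fourier coefficients of `posSum (fun _ => True) k N lam`. -/
def posCoeff (k N : ℕ) [NeZero N] (lam : ZMod N × ZMod N) (j : ℕ) : ℂ :=
  (2 * Real.pi * Complex.I) ^ k * ((-1) ^ k / ((N : ℂ) ^ k * (k - 1).factorial) *
    ∑ x ∈ j.divisorsAntidiagonal, if (x.1 : ZMod N) = lam.1 then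
      (x.2 : ℂ) ^ (k - 1) * ZMod.stdAddChar ((x.2 : ZMod N) * lam.2) else 0)

theorem tsum_residue_eq {k : ℕ} (hk : 3 ≤ k) {N : ℕ} [NeZero N] (b : ZMod N) (τ : ℍ) (c : ℕ+) :
    ∑' d : ℤ, (if (d : ZMod N) = b then ((c : ℂ) * (τ : ℂ) + (d : ℂ)) ^ (-(k : ℤ)) else 0) =
      ∑' n : ℕ+, (2 * Real.pi * Complex.I) ^ k * ((-1) ^ k / ((N : ℂ) ^ k * (k - 1).factorial)) *
        ((n : ℂ) ^ (k - 1) * ZMod.stdAddChar (((n : ℕ) : ZMod N) * b) *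
          Complex.exp (2 * Real.pi * Complex.I * τ / N) ^ ((c : ℕ) * n)) := by
  have hN : (N : ℂ) ≠ 0 := NeZero.ne _
  have hN' : (N : ℝ) ≠ 0 := NeZero.ne _
  have hNpos : (0 : ℝ) < N := by positivity
  have hinj : Function.Injective fun m : ℤ => (b.val : ℤ) + N * m := fun m m' h => by
    simpa [NeZero.ne N] using h
  rw [← hinj.tsum_eq]
  swap
  · intro d hd
    have hd' : (d : ZMod N) = b := by
      by_contra h
      simp [h] at hd
    have : ((d - b.val : ℤ) : ZMod N) = 0 := by simp [hd']
    obtain ⟨m, hm⟩ := (ZMod.intCast_zmod_eq_zero_iff_dvd _ N).mp this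
    exact ⟨m, by simp only; omega⟩
  let z : ℍ := ⟨((c : ℂ) * τ + b.val) / N, by
    have : (((c : ℂ) * τ + b.val) / N).im = c * τ.im / N := by
      rw [← ofReal_natCast N, div_ofReal_im]
      simp [-ZMod.natCast_val]
    rw [this]
    have := τ.im_pos
    positivity⟩
  have hz : (z : ℂ) = ((c : ℂ) * τ + b.val) / N := rfl
  have hL := EisensteinSeries.qExpansion_identity_pnat (k := k - 1) (by omega) z
  rw [show k - 1 + 1 = k by omega] at hL
  have h1 : ∀ m : ℤ, (if (((b.val : ℤ) + N * m : ℤ) : ZMod N) = b then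
      ((c : ℂ) * (τ : ℂ) + (((b.val : ℤ) + N * m : ℤ) : ℂ)) ^ (-(k : ℤ)) else 0)
      = ((N : ℂ) ^ k)⁻¹ * (1 / ((z : ℂ) + m) ^ k) := by
    intro m
    rw [if_pos (by simp), hz, zpow_neg, zpow_natCast, one_div, ← mul_inv, ← mul_pow]
    congr 2
    push_cast
    field_simp
    ring
  rw [tsum_congr h1, tsum_mul_left, hL, tsum_mul_left, ← mul_assoc]
  congr 1
  · rw [show (-2 * Real.pi * Complex.I : ℂ) = (-1) * (2 * Real.pi * Complex.I) by ring, mul_pow]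
    field_simp
  · refine tsum_congr fun n => ?_
    rw [mul_assoc ((n : ℂ) ^ (k - 1))]
    refine congrArg _ ?_
    have := ZMod.stdAddChar_coe (N := N) (n * b.val)
    push_cast at this
    rw [ZMod.natCast_zmod_val] at this
    rw [this, hz, ← Complex.exp_nat_mul, ← Complex.exp_nat_mul, ← Complex.exp_add]
    push_cast
    congr 1
    field_simp
    ring

theorem hasSum_posSum {k : ℕ} (hk : 3 ≤ k) {N : ℕ} [NeZero N] (lam : ZMod N × ZMod N) (τ : ℍ) :
    HasSum (fun j : ℕ => posCoeff k N lam j *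
      Complex.exp (2 * Real.pi * Complex.I * (j : ℂ) * (τ : ℂ) / (N : ℂ)))
      (posSum (fun _ => True) k N lam τ) := by
  set q := Complex.exp (2 * Real.pi * Complex.I * τ / N) with hq
  have hq1 : ‖q‖ < 1 := by
    rw [hq, Complex.norm_exp, Real.exp_lt_one_iff]
    have : (2 * Real.pi * Complex.I * τ / N : ℂ).re = -(2 * Real.pi * τ.im / N) := by
      rw [← ofReal_natCast, div_ofReal_re]
      simp
      ring
    rw [this]
    have := τ.im_pos
    have := Real.pi_pos
    have : (0 : ℝ) < N := by exact_mod_cast NeZero.pos N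
    exact neg_lt_zero.mpr (by positivity)
  set C : ℂ := (2 * Real.pi * Complex.I) ^ k * ((-1) ^ k / ((N : ℂ) ^ k * (k - 1).factorial))
    with hC
  let F : ℕ+ × ℕ+ → ℂ := fun x => if ((x.1 : ℕ) : ZMod N) = lam.1 then
    C * ((x.2 : ℂ) ^ (k - 1) * ZMod.stdAddChar (((x.2 : ℕ) : ZMod N) * lam.2) *
      q ^ ((x.1 : ℕ) * x.2)) else 0
  have hFs : Summable F := by
    refine Summable.of_norm_bounded ((summable_prod_mul_pow (k - 1) hq1).norm.mul_left ‖C‖) ?_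
    intro x
    simp only [F]
    split_ifs
    · simp [AddChar.norm_apply]
    · rw [norm_zero]
      positivity
  have hF : posSum (fun _ => True) k N lam τ = ∑' x, F x := by
    rw [posSum, (summable_norm_ite_eis hk _ τ).of_norm.tsum_prod, hFs.tsum_prod]
    have hinj : Function.Injective fun c : ℕ+ => ((c : ℕ) : ℤ) := fun c c' h => by
      simpa using h
    rw [← hinj.tsum_eq]
    · refine tsum_congr fun c => ?_
      simp only [F]
      split_ifs with h
      · rw [← tsum_residue_eq hk lam.2 τ c]
        simp [h]
      · simp [h]
    · intro c hc
      have : 0 < c := by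
        by_contra h
        simp [h] at hc
      exact ⟨⟨c.toNat, by omega⟩, by simp; omega⟩
  have h1 := hFs.hasSum
  rw [← hF, ← sigmaAntidiagonalEquivProd.hasSum_iff] at h1
  have h2 := h1.sigma fun j => hasSum_fintype _
  rw [← PNat.coe_injective.hasSum_iff]
  · convert h2 using 1
    funext j
    refine Eq.trans ?_ (Finset.sum_coe_sort (j : ℕ).divisorsAntidiagonal (fun x : ℕ × ℕ =>
      if (x.1 : ZMod N) = lam.1 then C * ((x.2 : ℂ) ^ (k - 1) *
        ZMod.stdAddChar ((x.2 : ZMod N) * lam.2) * q ^ (x.1 * x.2)) else 0)).symm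
    change posCoeff k N lam (j : ℕ) *
      Complex.exp (2 * Real.pi * Complex.I * ((j : ℕ) : ℂ) * (τ : ℂ) / (N : ℂ)) = _
    rw [posCoeff, ← mul_assoc, ← hC, Finset.mul_sum, Finset.sum_mul]
    refine Finset.sum_congr rfl fun x hx => ?_
    rw [(Nat.mem_divisorsAntidiagonal.mp hx).1, hq, ← Complex.exp_nat_mul]
    split_ifs
    · ring_nf
    · simp
  · intro j hj
    have : j = 0 := by
      by_contra h
      exact hj ⟨⟨j, Nat.pos_of_ne_zero h⟩, rfl⟩
    simp [this, posCoeff]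

theorem posCoeff_div_mem {k : ℕ} {N : ℕ} [NeZero N] {K : Subfield ℂ}
    (hK : ∀ a : ZMod N, ZMod.stdAddChar a ∈ K) (lam : ZMod N × ZMod N) (j : ℕ) :
    posCoeff k N lam j / (2 * Real.pi * Complex.I) ^ k ∈ K := by
  have h : (2 * Real.pi * Complex.I : ℂ) ^ k ≠ 0 := pow_ne_zero _ Complex.two_pi_I_ne_zero
  rw [posCoeff, mul_div_cancel_left₀ _ h]
  refine mul_mem (div_mem (pow_mem (neg_mem (one_mem K)) k)
    (mul_mem (pow_mem (natCast_mem K N) k) (natCast_mem K _))) (sum_mem fun x _ => ?_)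
  split_ifs
  · exact mul_mem (pow_mem (natCast_mem K _) _) (hK _)
  · exact zero_mem K

theorem posSum_eq_conv {k : ℕ} (hk : 3 ≤ k) {N : ℕ} [NeZero N] {lam : ZMod N × ZMod N}
    (hlam : IsCoprime lam.1 lam.2) (τ : ℍ) :
    posSum (fun _ => True) k N lam τ = ∑ u : (ZMod N)ˣ, (partialZeta k N u : ℂ) *
      posSum (fun cd => Int.gcd cd.1 cd.2 = 1) k N (u⁻¹ • lam) τ := by
  have hz : ∀ u : ZMod N, (partialZeta k N u : ℂ) =
      ∑' n : ℕ, if (n : ZMod N) = u then 1 / (n : ℂ) ^ k else 0 := fun u => by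
    rw [partialZeta, ofReal_tsum]
    refine tsum_congr fun n => ?_
    split_ifs <;> simp
  have hzs : ∀ u : ZMod N,
      Summable fun n : ℕ => ‖if (n : ZMod N) = u then 1 / (n : ℂ) ^ k else 0‖ := fun u =>
    (summable_partialZeta hk u).congr fun n => by split_ifs <;> simp
  have hps := fun u : (ZMod N)ˣ => summable_norm_ite_eis hk (fun cd : ℤ × ℤ => 0 < cd.1 ∧
    Int.gcd cd.1 cd.2 = 1 ∧ (cd.1 : ZMod N) = (u⁻¹ • lam).1 ∧ (cd.2 : ZMod N) = (u⁻¹ • lam).2) τ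
  simp only [hz, posSum]
  rw [Finset.sum_congr rfl fun (u : (ZMod N)ˣ) _ => tsum_mul_tsum_of_summable_norm (hzs u) (hps u),
    ← Summable.tsum_finsetSum fun (u : (ZMod N)ˣ) _ =>
      summable_mul_of_summable_norm (hzs u) (hps u)]
  have hsum : ∀ x : ℕ × (ℤ × ℤ), ∑ u : (ZMod N)ˣ,
      (if (x.1 : ZMod N) = u then 1 / (x.1 : ℂ) ^ k else 0) *
        (if 0 < x.2.1 ∧ Int.gcd x.2.1 x.2.2 = 1 ∧ (x.2.1 : ZMod N) = (u⁻¹ • lam).1 ∧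
          (x.2.2 : ZMod N) = (u⁻¹ • lam).2
        then ((x.2.1 : ℂ) * (τ : ℂ) + (x.2.2 : ℂ)) ^ (-(k : ℤ)) else 0) =
      if 0 < x.1 ∧ 0 < x.2.1 ∧ Int.gcd x.2.1 x.2.2 = 1 ∧ (x.1 * x.2.1 : ZMod N) = lam.1 ∧
        (x.1 * x.2.2 : ZMod N) = lam.2
      then ((x.1 * x.2.1 : ℂ) * (τ : ℂ) + (x.1 * x.2.2 : ℂ)) ^ (-(k : ℤ)) else 0 := by
    rintro ⟨n, c, d⟩
    dsimp only
    rcases Nat.eq_zero_or_pos n with rfl | hn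
    · simp [show k ≠ 0 by omega]
    by_cases hunit : IsUnit (n : ZMod N)
    · obtain ⟨u, hu⟩ := hunit
      rw [Finset.sum_eq_single u]
      · have hiff : ∀ (a b : ZMod N), a = u⁻¹ • b ↔ n * a = b := fun a b => by
          rw [← hu, eq_inv_smul_iff, Units.smul_def, smul_eq_mul]
        simp only [Prod.smul_fst, Prod.smul_snd, hiff, hu, if_true, hn, true_and]
        split_ifs
        · rw [mul_assoc, ← mul_add, mul_zpow, zpow_neg (n : ℂ), zpow_natCast, one_div]
        · simp
      · intro v _ hv
        rw [if_neg, zero_mul]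
        rw [← hu]
        exact fun h => hv (Units.ext h).symm
      · simp
    · rw [if_neg, Finset.sum_eq_zero]
      · intro u _
        rw [if_neg, zero_mul]
        exact fun h => hunit (h ▸ u.isUnit)
      · rintro ⟨-, -, -, h1, h2⟩
        obtain ⟨a, b, hab⟩ := hlam
        refine hunit (IsUnit.of_mul_eq_one (a * c + b * d) ?_)
        rw [← hab, ← h1, ← h2]
        ring
  simp only [hsum]
  refine tsum_eq_tsum_of_ne_zero_bij (fun x => (x.1.1 * x.1.2.1, x.1.1 * x.1.2.2)) ?_ ?_ ?_
  · rintro ⟨⟨n, c, d⟩, hx⟩ ⟨⟨n', c', d'⟩, hx'⟩ h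
    simp only [Function.mem_support, ne_eq, ite_eq_right_iff, Classical.not_imp] at hx hx'
    simp only [Prod.mk.injEq] at h
    obtain ⟨⟨hn, -, hg, -⟩, -⟩ := hx
    obtain ⟨⟨hn', -, hg', -⟩, -⟩ := hx'
    have hnn : n = n' := by
      have h1 : Int.gcd (n * c) (n * d) = n := by rw [Int.gcd_mul_left, hg]; simp
      have h2 : Int.gcd (n' * c') (n' * d') = n' := by rw [Int.gcd_mul_left, hg']; simp
      rw [← h1, ← h2, h.1, h.2]
    subst hnn
    have : (n : ℤ) ≠ 0 := by omega
    have h1 := mul_left_cancel₀ this h.1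
    have h2 := mul_left_cancel₀ this h.2
    simp [h1, h2]
  · rintro ⟨c, d⟩ hx
    simp only [Function.mem_support, ne_eq, ite_eq_right_iff, Classical.not_imp] at hx
    obtain ⟨⟨hc, -, h1, h2⟩, h0⟩ := hx
    have hg : 0 < Int.gcd c d := Int.gcd_pos_of_ne_zero_left _ hc.ne'
    obtain ⟨c', hc'⟩ := Int.gcd_dvd_left c d
    obtain ⟨d', hd'⟩ := Int.gcd_dvd_right c d
    set n := Int.gcd c d with hn
    have hgcd : Int.gcd c' d' = 1 := by
      have : n * Int.gcd c' d' = n * 1 := by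
        conv_rhs => rw [hn, hc', hd', Int.gcd_mul_left]
        simp
      exact Nat.eq_of_mul_eq_mul_left hg this
    refine ⟨⟨(n, c', d'), ?_⟩, by simp [← hc', ← hd']⟩
    have hcpos : 0 < c' := by
      rw [hc'] at hc
      exact pos_of_mul_pos_right hc (by omega)
    have e1 := congrArg (Int.cast (R := ZMod N)) hc'
    have e2 := congrArg (Int.cast (R := ZMod N)) hd'
    have e3 := congrArg (Int.cast (R := ℂ)) hc'
    have e4 := congrArg (Int.cast (R := ℂ)) hd'
    push_cast at e1 e2 e3 e4
    simp only [Function.mem_support, ne_eq, ite_eq_right_iff, Classical.not_imp]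
    refine ⟨⟨hg, hcpos, hgcd, by rw [← e1, h1], by rw [← e2, h2]⟩, ?_⟩
    rw [← e3, ← e4]
    exact h0
  · rintro ⟨⟨n, c, d⟩, hx⟩
    simp only [Function.mem_support, ne_eq, ite_eq_right_iff, Classical.not_imp] at hx
    obtain ⟨⟨hn, hc, hg, h1, h2⟩, h0⟩ := hx
    have : 0 < (n : ℤ) * c := by positivity
    simp only [Int.cast_mul, Int.cast_natCast, h1, h2, this, hn, hc, hg, and_self]

theorem isCoprime_of_addOrderOf_eq {N : ℕ} [NeZero N] {lam : ZMod N × ZMod N}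
    (h : addOrderOf lam = N) : IsCoprime lam.1 lam.2 := by
  set g := Nat.gcd (Nat.gcd lam.1.val lam.2.val) N with hg
  have hgN : g ∣ N := Nat.gcd_dvd_right _ _
  have hg1 : g ∣ lam.1.val := (Nat.gcd_dvd_left _ _).trans (Nat.gcd_dvd_left _ _)
  have hg2 : g ∣ lam.2.val := (Nat.gcd_dvd_left _ _).trans (Nat.gcd_dvd_right _ _)
  have hzero : ∀ a : ZMod N, g ∣ a.val → (N / g) • a = 0 := fun a ha => by
    obtain ⟨m, hm⟩ := ha
    have : (N / g) * a.val = N * m := by rw [hm, ← mul_assoc, Nat.div_mul_cancel hgN]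
    rw [nsmul_eq_mul, ← ZMod.natCast_zmod_val a, ← Nat.cast_mul, this]
    simp
  have hdvd : N ∣ N / g := by
    conv_lhs => rw [← h]
    exact addOrderOf_dvd_of_nsmul_eq_zero (Prod.ext (hzero _ hg1) (hzero _ hg2))
  have hN : 0 < N := NeZero.pos N
  have hg1 : g = 1 := by
    have hgpos : 0 < g := Nat.gcd_pos_of_pos_right _ hN
    have h1 := Nat.le_of_dvd (Nat.div_pos (Nat.le_of_dvd hN hgN) hgpos) hdvd
    by_contra hne
    exact absurd (Nat.div_lt_self hN (by omega : 1 < g)) (by omega)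
  have hbez := Nat.gcd_eq_gcd_ab (Nat.gcd lam.1.val lam.2.val) N
  rw [← hg, hg1, Nat.gcd_eq_gcd_ab lam.1.val lam.2.val] at hbez
  have hb := congrArg (Int.cast (R := ZMod N)) hbez
  push_cast at hb
  simp only [ZMod.natCast_zmod_val, CharP.cast_eq_zero, zero_mul, add_zero] at hb
  rw [add_mul, mul_comm lam.1, mul_comm lam.2, mul_right_comm, mul_right_comm _ lam.2] at hb
  exact ⟨_, _, hb.symm⟩

theorem posSum_symm_hasSum {k : ℕ} (hk : 3 ≤ k) {N : ℕ} [NeZero N] {K : Subfield ℂ}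
    (hK : Complex.exp (2 * Real.pi * Complex.I / (N : ℂ)) ∈ K) {lam : ZMod N × ZMod N}
    (hlam : IsCoprime lam.1 lam.2) :
    ∃ A : ℕ → ℂ, (∀ j, A j ∈ K) ∧ ∀ τ : ℍ,
      HasSum (fun j : ℕ => A j *
        Complex.exp (2 * Real.pi * Complex.I * (j : ℂ) * (τ : ℂ) / (N : ℂ)))
        (posSum (fun cd => Int.gcd cd.1 cd.2 = 1) k N lam τ +
          (-1) ^ k * posSum (fun cd => Int.gcd cd.1 cd.2 = 1) k N (-lam) τ) := by
  have hz : ∀ u : (ZMod N)ˣ, 0 ≤ partialZeta k N u := fun u => partialZeta_nonneg k _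
  have hz1 : ∑ u : (ZMod N)ˣ, partialZeta k N u < 2 * partialZeta k N ((1 : (ZMod N)ˣ) : ZMod N) := by
    have := one_le_partialZeta_one hk N
    have := sum_partialZeta_lt hk N
    rw [Units.val_one]
    linarith
  let T : ((ZMod N)ˣ → ℂ) →ₗ[ℂ] ((ZMod N)ˣ → ℂ) :=
    { toFun := fun D v => ∑ u : (ZMod N)ˣ, (partialZeta k N u : ℂ) * D (u⁻¹ * v)
      map_add' := fun D E => by
        funext v
        simp [mul_add, Finset.sum_add_distrib]
      map_smul' := fun c D => by
        funext v
        simp [Finset.mul_sum, mul_left_comm] }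
  have hT : Function.Injective T := by
    rw [injective_iff_map_eq_zero]
    exact fun D hD => eq_zero_of_conv_eq_zero hz hz1 fun v => congrFun hD v
  let S := LinearEquiv.ofInjectiveEndo T hT
  have hS : ∀ D, S D = T D := fun D => rfl
  let g : ℕ → (ZMod N)ˣ → ℂ := fun j v =>
    posCoeff k N (v • lam) j + (-1) ^ k * posCoeff k N (-(v • lam)) j
  let p : ℍ → (ZMod N)ˣ → ℂ := fun τ v =>
    posSum (fun cd => Int.gcd cd.1 cd.2 = 1) k N (v • lam) τ +
      (-1) ^ k * posSum (fun cd => Int.gcd cd.1 cd.2 = 1) k N (-(v • lam)) τ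
  have hcop : ∀ v : (ZMod N)ˣ, IsCoprime (v • lam).1 (v • lam).2 := fun v => by
    obtain ⟨a, b, hab⟩ := hlam
    refine ⟨a * (v⁻¹ : (ZMod N)ˣ), b * (v⁻¹ : (ZMod N)ˣ), ?_⟩
    simp [Units.smul_def, mul_assoc, hab]
  have hTp : ∀ τ v, T (p τ) v = posSum (fun _ => True) k N (v • lam) τ +
      (-1) ^ k * posSum (fun _ => True) k N (-(v • lam)) τ := fun τ v => by
    rw [posSum_eq_conv hk (hcop v), posSum_eq_conv hk (lam := -(v • lam)) (hcop v).neg_neg,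
      Finset.mul_sum, ← Finset.sum_add_distrib]
    refine Finset.sum_congr rfl fun u _ => ?_
    rw [smul_neg, ← mul_smul]
    ring
  have hGsum : ∀ τ : ℍ, HasSum (fun j : ℕ =>
      Complex.exp (2 * Real.pi * Complex.I * (j : ℂ) * (τ : ℂ) / (N : ℂ)) • g j) (S (p τ)) := by
    intro τ
    rw [Pi.hasSum]
    intro v
    rw [hS, hTp]
    convert! (hasSum_posSum hk (v • lam) τ).add
      ((hasSum_posSum hk (-(v • lam)) τ).mul_left ((-1) ^ k)) using 1
    funext j
    simp only [g, Pi.smul_apply, smul_eq_mul]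
    ring
  refine ⟨fun j => S.symm (g j) 1, fun j => ?_, fun τ => ?_⟩
  · refine mem_of_conv_eq hz hz1 K (s := -1) (by simp) (σ := (-1) ^ k)
      (pow_mem (neg_mem (one_mem K)) k) (C := (2 * Real.pi * Complex.I) ^ k)
      (pow_ne_zero _ Complex.two_pi_I_ne_zero) (fun u => ?_) (g := g j) (fun v => ?_)
      (fun v => ?_) (fun v => ?_) 1
    · simpa using partialZeta_symm_div_mem hk hK (u : ZMod N)
    · simp only [g, add_div, mul_div_assoc]
      exact add_mem (posCoeff_div_mem (stdAddChar_mem hK) _ j)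
        (mul_mem (pow_mem (neg_mem (one_mem K)) k) (posCoeff_div_mem (stdAddChar_mem hK) _ j))
    · have h1 : ((-1 : (ZMod N)ˣ) * v) • lam = -(v • lam) := by
        simp [Units.smul_def]
      have h2 : ((-1 : ℂ) ^ k) * (-1) ^ k = 1 := by rw [← mul_pow]; simp
      simp only [g, h1, neg_neg, mul_add, ← mul_assoc, h2]
      ring
    · exact congrFun ((hS _).symm.trans (S.apply_symm_apply (g j))) v
  · have h1 := Pi.hasSum.mp ((hGsum τ).mapL (LinearMap.toContinuousLinearMap S.symm.toLinearMap)) 1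
    simp only [LinearMap.coe_toContinuousLinearMap', LinearEquiv.coe_coe, map_smul,
      LinearEquiv.symm_apply_apply, Pi.smul_apply, smul_eq_mul, p, one_smul] at h1
    simpa only [mul_comm] using h1

theorem tsum_fst_eq_zero_mem (K : Subfield ℂ) (k N : ℕ) (lam : ZMod N × ZMod N) :
    ∃ a ∈ K, ∀ τ : ℍ, ∑' cd : ℤ × ℤ, (if cd.1 = 0 ∧ Int.gcd cd.1 cd.2 = 1 ∧
      (cd.1 : ZMod N) = lam.1 ∧ (cd.2 : ZMod N) = lam.2
      then ((cd.1 : ℂ) * (τ : ℂ) + (cd.2 : ℂ)) ^ (-(k : ℤ)) else 0) = a := by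
  refine ⟨∑ cd ∈ ({(0, 1), (0, -1)} : Finset (ℤ × ℤ)), (if cd.1 = 0 ∧ Int.gcd cd.1 cd.2 = 1 ∧
      (cd.1 : ZMod N) = lam.1 ∧ (cd.2 : ZMod N) = lam.2 then (cd.2 : ℂ) ^ (-(k : ℤ)) else 0),
    sum_mem fun cd _ => ?_, fun τ => ?_⟩
  · split_ifs
    · exact zpow_mem (intCast_mem K _) _
    · exact zero_mem K
  · rw [tsum_eq_sum (s := ({(0, 1), (0, -1)} : Finset (ℤ × ℤ)))]
    · refine Finset.sum_congr rfl fun cd _ => ?_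
      split_ifs with h
      · simp [h.1]
      · rfl
    · rintro ⟨c, d⟩ hcd
      rw [if_neg]
      rintro ⟨hc, hg, -⟩
      simp only at hc hg
      subst hc
      rw [Int.gcd_zero_left] at hg
      rcases Int.natAbs_eq_iff.mp hg with h | h <;> simp [h] at hcd

theorem Ek_eq_add {k : ℕ} (hk : 3 ≤ k) (N : ℕ) (lam : ZMod N × ZMod N) (τ : ℍ) :
    Ek k N lam τ = epsN N * ((∑' cd : ℤ × ℤ, (if cd.1 = 0 ∧ Int.gcd cd.1 cd.2 = 1 ∧
      (cd.1 : ZMod N) = lam.1 ∧ (cd.2 : ZMod N) = lam.2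
      then ((cd.1 : ℂ) * (τ : ℂ) + (cd.2 : ℂ)) ^ (-(k : ℤ)) else 0)) +
      (posSum (fun cd => Int.gcd cd.1 cd.2 = 1) k N lam τ +
          (-1) ^ k * posSum (fun cd => Int.gcd cd.1 cd.2 = 1) k N (-lam) τ)) := by
  have hneg : (-1) ^ k * posSum (fun cd => Int.gcd cd.1 cd.2 = 1) k N (-lam) τ =
      ∑' cd : ℤ × ℤ, if cd.1 < 0 ∧ Int.gcd cd.1 cd.2 = 1 ∧
        (cd.1 : ZMod N) = lam.1 ∧ (cd.2 : ZMod N) = lam.2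
        then ((cd.1 : ℂ) * (τ : ℂ) + (cd.2 : ℂ)) ^ (-(k : ℤ)) else 0 := by
    rw [posSum, ← (Equiv.neg (ℤ × ℤ)).tsum_eq, ← tsum_mul_left]
    refine tsum_congr fun cd => ?_
    have h : ∀ x : ℂ, (-x) ^ (-(k : ℤ)) = (-1) ^ k * x ^ (-(k : ℤ)) := fun x => by
      rw [zpow_neg, zpow_neg, zpow_natCast, zpow_natCast, neg_pow, mul_inv, ← inv_pow]
      norm_num
    have h2 : (-1 : ℂ) ^ k * (-1) ^ k = 1 := by rw [← mul_pow]; simp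
    have h3 : -(cd.1 : ℂ) * τ + -(cd.2 : ℂ) = -((cd.1 : ℂ) * τ + cd.2) := by ring
    simp only [Equiv.neg_apply, Prod.fst_neg, Prod.snd_neg, Int.gcd_neg, Int.neg_gcd, h3, h,
      Left.neg_pos_iff, Int.cast_neg, neg_inj]
    split_ifs
    · rw [← mul_assoc, h2, one_mul]
    · simp
  rw [hneg, posSum, Ek, ← Summable.tsum_add (summable_norm_ite_eis hk _ τ).of_norm
    (summable_norm_ite_eis hk _ τ).of_norm, ← Summable.tsum_add
    (summable_norm_ite_eis hk _ τ).of_norm ((summable_norm_ite_eis hk _ τ).of_norm.add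
    (summable_norm_ite_eis hk _ τ).of_norm)]
  congr 1
  refine tsum_congr fun cd => ?_
  rcases lt_trichotomy cd.1 0 with h | h | h
  · simp [h, h.ne, h.not_gt]
  · simp [h]
  · simp [h, h.ne', h.not_gt]

theorem Ek_hasSum {k : ℕ} (hk : 3 ≤ k) {N : ℕ} [NeZero N] {K : Subfield ℂ}
    (hK : Complex.exp (2 * Real.pi * Complex.I / (N : ℂ)) ∈ K) {lam : ZMod N × ZMod N}
    (hlam : addOrderOf lam = N) :
    ∃ A : ℕ → ℂ, (∀ j, A j ∈ K) ∧ ∀ τ : ℍ,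
      HasSum (fun j : ℕ => A j *
        Complex.exp (2 * Real.pi * Complex.I * (j : ℂ) * (τ : ℂ) / (N : ℂ))) (Ek k N lam τ) := by
  obtain ⟨a, ha, ha'⟩ := tsum_fst_eq_zero_mem K k N lam
  obtain ⟨A, hA, hA'⟩ := posSum_symm_hasSum hk hK (isCoprime_of_addOrderOf_eq hlam)
  refine ⟨fun j => epsN N * ((if j = 0 then a else 0) + A j), fun j => mul_mem ?_ (add_mem ?_ (hA j)),
    fun τ => ?_⟩
  · rw [epsN]
    split_ifs
    · exact one_mem K
    · exact div_mem (one_mem K) (ofNat_mem K 2)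
  · split_ifs
    · exact ha
    · exact zero_mem K
  · rw [Ek_eq_add hk, ha']
    convert! ((hasSum_ite_eq 0 a).add (hA' τ)).mul_left (epsN N) using 1
    funext j
    by_cases h : j = 0
    · simp [h]
    · simp only [if_neg h]
      ring

/-- For `k ≥ 3` and a subfield `𝕜 ⊆ ℂ` containing `ζ_N`, every
element of the `𝕜`-span of the `E_k(·, λ̄, N)` has a Fourier expansion
`Σ_{j≥0} A_j e(jτ/N)` with all `A_j ∈ 𝕜`; in particular every `E_k(·, λ̄, N)` has all
Fourier coefficients in `ℚ(ζ_N)`. -/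
theorem eisenstein_fourier_coeffs_in_subfield (k N : ℕ) (hk : 3 ≤ k) (hN : 1 ≤ N) :
    (∀ (K : Subfield ℂ), Complex.exp (2 * Real.pi * Complex.I / (N : ℂ)) ∈ K →
      ∀ f : ℍ → ℂ, inSpanE k N (K : Set ℂ) f →
        ∃ A : ℕ → ℂ, (∀ j, A j ∈ K) ∧
          ∀ τ : ℍ, f τ = ∑' j : ℕ,
            A j * Complex.exp (2 * Real.pi * Complex.I * (j : ℂ) * (τ : ℂ) / (N : ℂ))) ∧
    (∀ lam : ZMod N × ZMod N, addOrderOf lam = N →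
      ∃ A : ℕ → ℂ,
        (∀ j, A j ∈ Subfield.closure {Complex.exp (2 * Real.pi * Complex.I / (N : ℂ))}) ∧
        ∀ τ : ℍ, Ek k N lam τ = ∑' j : ℕ,
          A j * Complex.exp (2 * Real.pi * Complex.I * (j : ℂ) * (τ : ℂ) / (N : ℂ))) := by
  have : NeZero N := ⟨by omega⟩
  refine ⟨fun K hK f hf => ?_, fun lam hlam => ?_⟩
  · obtain ⟨c, hc, hf⟩ := hf
    choose! A hA hA' using fun lam (h : addOrderOf lam = N) => Ek_hasSum hk hK h
    refine ⟨fun j => ∑ lam, if addOrderOf lam = N then c lam * A lam j else 0,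
      fun j => sum_mem fun lam _ => ?_, fun τ => ?_⟩
    · split_ifs with h
      · exact mul_mem (hc lam) (hA lam h j)
      · exact zero_mem K
    · rw [hf τ, tsum_fintype]
      refine (HasSum.tsum_eq ?_).symm
      simp only [Finset.sum_mul]
      refine hasSum_sum fun lam _ => ?_
      split_ifs with h
      · simpa only [mul_assoc] using (hA' lam h τ).mul_left (c lam)
      · simp
  · obtain ⟨A, hA, hA'⟩ := Ek_hasSum hk (Subfield.subset_closure (Set.mem_singleton _)) hlam
    exact ⟨A, hA, fun τ => (hA' τ).tsum_eq.symm⟩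
end
end

section
/- Let N ≥ 3 and k ≥ 3 be integers, let δ be a divisor of N with 1 ≤ δ < N/2, and let λ₀ ∈ ℤ with gcd(λ₀, gcd(δ, N/δ)) = 1. For Dirichlet characters χ₁ modulo N/δ and χ₂ modulo δ define E^{(0)}_{k,χ₁,χ₂}((δ,λ₀), N) := Σ_{(a,λ₂) ∈ I} χ₁(a)·χ₂(λ₂)^{-1}·E_k^{(1)}((aδ, λ₂), N), where I := {(a,λ₂) ∈ ℤ² : 0 ≤ a ≤ N/δ − 1, gcd(a, N/δ) = 1, 0 ≤ λ₂ ≤ δ − 1, gcd(λ₂, δ) = 1, a·λ₂ ≡ λ₀ (mod gcd(δ, N/δ))}. If (χ₁, χ₂) and (χ₁', χ₂') are two such pairs whose level-raisings to modulus N have equal products (i.e. both factor the same Dirichlet character χ mod N), then there exists a nonzero complex number α with E^{(0)}_{k,χ₁,χ₂}((δ,λ₀), N) = α · E^{(0)}_{k,χ₁',χ₂'}((δ,λ₀), N). -/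
open Complex UpperHalfPlane

noncomputable section

/-- the orbital sum `E_k^{(1)}(λ, N)` for `Γ₁(N)`. -/
def Ek1 (k N : ℕ) (lam : ℤ × ℤ) : ℍ → ℂ :=
  fun τ => ∑ n ∈ Finset.range (N / Int.gcd lam.1 (N : ℤ)),
    Ek k N ((lam.1 : ZMod N), ((lam.2 + (Int.gcd lam.1 (N : ℤ) : ℤ) * (n : ℤ) : ℤ) : ZMod N)) τ

/-- the nebentypus Eisenstein series `E^{(0)}_{k,χ₁,χ₂}((δ,l₀), N)`. -/
def E0chi (k N δ : ℕ) (l₀ : ℤ)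
    (χ₁ : DirichletCharacter ℂ (N / δ)) (χ₂ : DirichletCharacter ℂ δ) : ℍ → ℂ :=
  fun τ => ∑ a ∈ Finset.range (N / δ), ∑ l ∈ Finset.range δ,
    if Nat.gcd a (N / δ) = 1 ∧ Nat.gcd l δ = 1 ∧
        (((a * l : ℕ) : ZMod (Nat.gcd δ (N / δ))) = ((l₀ : ℤ) : ZMod (Nat.gcd δ (N / δ))))
    then χ₁ (a : ZMod (N / δ)) * (χ₂ (l : ZMod δ))⁻¹ *
      Ek1 k N (((a : ℤ) * (δ : ℤ)), (l : ℤ)) τ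
    else 0

/-- Integers `a, a'` prime to `m` and `l, l'` prime to `n` with `a * l ≡ a' * l'` modulo
`gcd n m` admit a common ratio `x` prime to `m * n`, with `x ≡ a / a'` modulo `m` and
`x ≡ l' / l` modulo `n`. -/
theorem exists_coprime_common_ratio {m n : ℕ} [NeZero m] [NeZero n] {a a' l l' : ℕ}
    (ha : a.Coprime m) (ha' : a'.Coprime m) (hl : l.Coprime n) (hl' : l'.Coprime n)
    (h : ((a * l : ℕ) : ZMod (Nat.gcd n m)) = ((a' * l' : ℕ) : ZMod (Nat.gcd n m))) :
    ∃ x : ℕ, x.Coprime (m * n) ∧ (a : ZMod m) = x * a' ∧ (l' : ZMod n) = x * l := by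
  obtain ⟨b, hb⟩ : ∃ b : ℕ, ((a' * b : ℕ) : ZMod m) = (1 : ℕ) :=
    ⟨((a' : ZMod m)⁻¹).val, by simp [ZMod.coe_mul_inv_eq_one a' ha']⟩
  obtain ⟨c, hc⟩ : ∃ c : ℕ, ((l * c : ℕ) : ZMod n) = (1 : ℕ) :=
    ⟨((l : ZMod n)⁻¹).val, by simp [ZMod.coe_mul_inv_eq_one l hl]⟩
  have hbg := (ZMod.natCast_eq_natCast_iff _ _ _).2
    (((ZMod.natCast_eq_natCast_iff _ _ _).1 hb).of_dvd (Nat.gcd_dvd_right n m))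
  have hcg := (ZMod.natCast_eq_natCast_iff _ _ _).2
    (((ZMod.natCast_eq_natCast_iff _ _ _).1 hc).of_dvd (Nat.gcd_dvd_left n m))
  have hcompat : l' * c ≡ a * b [MOD Nat.gcd n m] := by
    rw [← ZMod.natCast_eq_natCast_iff]
    push_cast at h hbg hcg ⊢
    linear_combination (-(b : ZMod (Nat.gcd n m)) * c) * h - l' * c * hbg + a * b * hcg
  obtain ⟨x, hxn, hxm⟩ := Nat.chineseRemainder' hcompat
  have hxm' := (ZMod.natCast_eq_natCast_iff _ _ _).2 hxm
  have hxn' := (ZMod.natCast_eq_natCast_iff _ _ _).2 hxn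
  push_cast at hb hc hxm' hxn'
  have hax : (a : ZMod m) = x * a' := by
    linear_combination (-(a' : ZMod m)) * hxm' - (a : ZMod m) * hb
  have hlx : (l' : ZMod n) = x * l := by
    linear_combination (-(l : ZMod n)) * hxn' - (l' : ZMod n) * hc
  refine ⟨x, Nat.Coprime.mul_right ?_ ?_, hax, hlx⟩
  · rw [← ZMod.isUnit_iff_coprime] at ha ⊢
    exact isUnit_of_mul_isUnit_left (hax ▸ ha)
  · rw [← ZMod.isUnit_iff_coprime] at hl' ⊢
    exact isUnit_of_mul_isUnit_left (hlx ▸ hl')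

theorem DirichletCharacter.apply_natCast_ne_zero {n : ℕ} (χ : DirichletCharacter ℂ n) {a : ℕ}
    (ha : a.Coprime n) : χ (a : ZMod n) ≠ 0 :=
  (((ZMod.isUnit_iff_coprime a n).2 ha).map χ).ne_zero

theorem DirichletCharacter.changeLevel_natCast {n m : ℕ} (hm : n ∣ m)
    (χ : DirichletCharacter ℂ n) {x : ℕ} (hx : x.Coprime m) :
    changeLevel hm χ (x : ZMod m) = χ (x : ZMod n) := by
  have h := changeLevel_eq_cast_of_dvd χ hm (ZMod.unitOfCoprime x hx)
  rwa [ZMod.coe_unitOfCoprime, ZMod.cast_natCast hm] at h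

/-- If two pairs of characters modulo `m` and `n` have the same product modulo `N = m * n`, the
ratio of `χ₁ a / χ₂ l` and `χ₁' a / χ₂' l` depends only on `a * l` modulo `gcd n m`. -/
theorem DirichletCharacter.apply_div_apply_mul_eq {N m n : ℕ} [NeZero m] [NeZero n]
    (hN : m * n = N) (hm : m ∣ N) (hn : n ∣ N)
    {χ₁ χ₁' : DirichletCharacter ℂ m} {χ₂ χ₂' : DirichletCharacter ℂ n}
    (hsame : changeLevel hm χ₁ * changeLevel hn χ₂ = changeLevel hm χ₁' * changeLevel hn χ₂')
    {a a' l l' : ℕ}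
    (ha : a.Coprime m) (ha' : a'.Coprime m) (hl : l.Coprime n) (hl' : l'.Coprime n)
    (h : ((a * l : ℕ) : ZMod (Nat.gcd n m)) = ((a' * l' : ℕ) : ZMod (Nat.gcd n m))) :
    χ₁ a * (χ₂ l)⁻¹ * (χ₁' a' * (χ₂' l')⁻¹) = χ₁ a' * (χ₂ l')⁻¹ * (χ₁' a * (χ₂' l)⁻¹) := by
  obtain ⟨x, hx, hax, hlx⟩ := exists_coprime_common_ratio ha ha' hl hl' h
  have hx' : x.Coprime N := hN ▸ hx
  have key := congrArg (fun χ : DirichletCharacter ℂ N => χ (x : ZMod N)) hsame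
  simp only [MulChar.mul_apply, changeLevel_natCast _ _ hx'] at key
  have hxn : x.Coprime n := Nat.Coprime.coprime_dvd_right hn hx'
  have h₁ := χ₂.apply_natCast_ne_zero hl
  have h₂ := χ₂'.apply_natCast_ne_zero hl
  have h₃ := χ₂.apply_natCast_ne_zero hxn
  have h₄ := χ₂'.apply_natCast_ne_zero hxn
  rw [hax, hlx, map_mul, map_mul, map_mul, map_mul]
  field_simp
  linear_combination (χ₁ a' * χ₁' a') * key

/-- If two factorizations `(χ₁,χ₂)` and `(χ₁',χ₂')` of a character
mod `N` through moduli `N/δ` and `δ` have the same product, then the associated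
nebentypus Eisenstein series attached to `(δ,l₀)` agree up to a nonzero scalar. -/
theorem e0chi_factorizations_proportional (N k : ℕ) (hN : 3 ≤ N) (hk : 3 ≤ k)
    (δ : ℕ) (hδ : 1 ≤ δ) (hδ2 : 2 * δ < N) (hdvd : δ ∣ N)
    (l₀ : ℤ) (hl₀ : Int.gcd l₀ ((Nat.gcd δ (N / δ) : ℤ)) = 1)
    (χ₁ χ₁' : DirichletCharacter ℂ (N / δ)) (χ₂ χ₂' : DirichletCharacter ℂ δ)
    (hsame : DirichletCharacter.changeLevel (Nat.div_dvd_of_dvd hdvd) χ₁ *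
        DirichletCharacter.changeLevel hdvd χ₂ =
      DirichletCharacter.changeLevel (Nat.div_dvd_of_dvd hdvd) χ₁' *
        DirichletCharacter.changeLevel hdvd χ₂') :
    ∃ α : ℂ, α ≠ 0 ∧
      E0chi k N δ l₀ χ₁ χ₂ = fun τ => α * E0chi k N δ l₀ χ₁' χ₂' τ := by
  have hm0 : NeZero (N / δ) := ⟨(Nat.div_pos (by lia) hδ).ne'⟩
  have hn0 : NeZero δ := ⟨by lia⟩
  by_cases hex : ∃ a l : ℕ, Nat.gcd a (N / δ) = 1 ∧ Nat.gcd l δ = 1 ∧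
      (((a * l : ℕ) : ZMod (Nat.gcd δ (N / δ))) = ((l₀ : ℤ) : ZMod (Nat.gcd δ (N / δ))))
  · obtain ⟨a', l', ha', hl', h'⟩ := hex
    have h₁ := χ₁.apply_natCast_ne_zero ha'
    have h₁' := χ₁'.apply_natCast_ne_zero ha'
    have h₂ := χ₂.apply_natCast_ne_zero hl'
    have h₂' := χ₂'.apply_natCast_ne_zero hl'
    refine ⟨χ₁ a' * (χ₂ l')⁻¹ / (χ₁' a' * (χ₂' l')⁻¹), by positivity, ?_⟩
    funext τ
    simp only [E0chi, Finset.mul_sum]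
    refine Finset.sum_congr rfl fun a _ => Finset.sum_congr rfl fun l _ => ?_
    split_ifs with h
    · obtain ⟨ha, hl, hal⟩ := h
      have key := DirichletCharacter.apply_div_apply_mul_eq (Nat.div_mul_cancel hdvd) _ _ hsame
        ha ha' hl hl' (hal.trans h'.symm)
      rw [← mul_assoc, div_mul_eq_mul_div, ← key, mul_div_cancel_right₀ _ (by positivity)]
    · rw [mul_zero]
  · push Not at hex
    refine ⟨1, one_ne_zero, ?_⟩
    funext τ
    rw [one_mul]
    simp only [E0chi]
    refine Finset.sum_congr rfl fun a _ => Finset.sum_congr rfl fun l _ => ?_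
    rw [if_neg fun h => hex a l h.1 h.2.1 h.2.2, if_neg fun h => hex a l h.1 h.2.1 h.2.2]
end
end

section
/- Let N ≥ 3 and k ≥ 3 be integers and let λ = (λ₁, λ₂) ∈ ℤ² with gcd(λ₁, λ₂, N) = 1. Let γ = [[a,b],[c,d]] ∈ Γ₀(N) (so c ≡ 0 mod N) and let e ∈ ℤ with d·e ≡ 1 (mod N). Then E_k^{(1)}(λ, N)|_k γ = E_k^{(1)}((e·λ₁, d·λ₂), N). (This expresses the action of the diamond operator: ⟨d⟩ sends E_k^{(1)}((λ̄₁, λ̄₂), N) to E_k^{(1)}((d̄^{-1}λ̄₁, d̄λ̄₂), N).) -/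
open scoped MatrixGroups
open Complex UpperHalfPlane

noncomputable section

/-- Right multiplication of integral row vectors by a matrix in `SL(2,ℤ)`. -/
def rowMulEquiv (γ : SL2Z) : ℤ × ℤ ≃ ℤ × ℤ where
  toFun v := (v.1 * γ 0 0 + v.2 * γ 1 0, v.1 * γ 0 1 + v.2 * γ 1 1)
  invFun v := (v.1 * γ 1 1 - v.2 * γ 1 0, v.2 * γ 0 0 - v.1 * γ 0 1)
  left_inv v := by
    have h := γ.det_coe
    rw [Matrix.det_fin_two] at h
    ext
    · linear_combination v.1 * h
    · linear_combination v.2 * h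
  right_inv v := by
    have h := γ.det_coe
    rw [Matrix.det_fin_two] at h
    ext
    · linear_combination v.1 * h
    · linear_combination v.2 * h

lemma gcd_rowMulEquiv_eq_one_iff (γ : SL2Z) (v : ℤ × ℤ) :
    Int.gcd (rowMulEquiv γ v).1 (rowMulEquiv γ v).2 = 1 ↔ Int.gcd v.1 v.2 = 1 := by
  have h := γ.det_coe
  rw [Matrix.det_fin_two] at h
  simp only [← Int.isCoprime_iff_gcd_eq_one, rowMulEquiv, Equiv.coe_fn_mk]
  constructor
  · rintro ⟨r, s, hrs⟩
    exact ⟨r * γ 0 0 + s * γ 0 1, r * γ 1 0 + s * γ 1 1, by linear_combination hrs⟩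
  · rintro ⟨r, s, hrs⟩
    exact ⟨r * γ 1 1 - s * γ 0 1, s * γ 0 0 - r * γ 1 0,
      by linear_combination hrs + (r * v.1 + s * v.2) * h⟩

lemma cast_rowMulEquiv_eq_iff (N : ℕ) (γ : SL2Z) (v w : ℤ × ℤ) :
    (((rowMulEquiv γ v).1 : ZMod N) = (rowMulEquiv γ w).1 ∧
      ((rowMulEquiv γ v).2 : ZMod N) = (rowMulEquiv γ w).2) ↔
    ((v.1 : ZMod N) = w.1 ∧ (v.2 : ZMod N) = w.2) := by
  have h := congrArg (Int.cast : ℤ → ZMod N) γ.det_coe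
  rw [Matrix.det_fin_two] at h
  push_cast at h
  simp only [rowMulEquiv, Equiv.coe_fn_mk]
  push_cast
  constructor
  · rintro ⟨h₁, h₂⟩
    constructor
    · linear_combination (γ 1 1 : ZMod N) * h₁ - (γ 1 0 : ZMod N) * h₂ - (v.1 - w.1 : ZMod N) * h
    · linear_combination (γ 0 0 : ZMod N) * h₂ - (γ 0 1 : ZMod N) * h₁ - (v.2 - w.2 : ZMod N) * h
  · rintro ⟨h₁, h₂⟩
    rw [h₁, h₂]
    exact ⟨rfl, rfl⟩

lemma slash_linear_factor (γ : SL2Z) (τ : ℍ) (v : ℤ × ℤ) :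
    ((γ 1 0 : ℂ) * (τ : ℂ) + (γ 1 1 : ℂ)) * ((v.1 : ℂ) * ((γ • τ : ℍ) : ℂ) + (v.2 : ℂ)) =
      ((rowMulEquiv γ v).1 : ℂ) * (τ : ℂ) + ((rowMulEquiv γ v).2 : ℂ) := by
  have hne : (γ 1 0 : ℂ) * (τ : ℂ) + (γ 1 1 : ℂ) ≠ 0 := by
    simpa [UpperHalfPlane.denom] using UpperHalfPlane.denom_ne_zero (γ : GL (Fin 2) ℝ) τ
  rw [UpperHalfPlane.specialLinearGroup_apply]
  simp only [rowMulEquiv, Equiv.coe_fn_mk, algebraMap_int_eq, eq_intCast]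
  push_cast
  field_simp
  ring

/-- The weight `k` slash action permutes the level `N` Eisenstein series by right multiplication
on the congruence class. -/
lemma slashf_Ek (k N : ℕ) (γ : SL2Z) (w : ℤ × ℤ) :
    slashf k γ (Ek k N ((w.1 : ZMod N), (w.2 : ZMod N))) =
      Ek k N (((rowMulEquiv γ w).1 : ZMod N), ((rowMulEquiv γ w).2 : ZMod N)) := by
  funext τ
  simp only [slashf, Ek]
  rw [mul_left_comm, ← tsum_mul_left]
  congr 1
  rw [← (rowMulEquiv γ).tsum_eq (fun v : ℤ × ℤ => if Int.gcd v.1 v.2 = 1 ∧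
    (v.1 : ZMod N) = ((rowMulEquiv γ w).1 : ZMod N) ∧
    (v.2 : ZMod N) = ((rowMulEquiv γ w).2 : ZMod N)
    then ((v.1 : ℂ) * (τ : ℂ) + (v.2 : ℂ)) ^ (-(k : ℤ)) else 0)]
  refine tsum_congr fun v => ?_
  simp only [gcd_rowMulEquiv_eq_one_iff, cast_rowMulEquiv_eq_iff, mul_ite, mul_zero,
    ← mul_zpow, slash_linear_factor]

lemma sum_range_affine_of_periodic {A : Type*} [AddCommMonoid A] {M : ℕ} (hM : 0 < M)
    {f : ℤ → A} (hf : ∀ x y : ℤ, x ≡ y [ZMOD M] → f x = f y) {d : ℤ} (hd : IsCoprime d M)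
    (t : ℤ) :
    ∑ n ∈ Finset.range M, f (d * n + t) = ∑ n ∈ Finset.range M, f n := by
  have hM' : (0 : ℤ) < M := by exact_mod_cast hM
  have hcast (n : ℕ) : (((d * n + t) % M).toNat : ℤ) = (d * n + t) % M :=
    Int.toNat_of_nonneg (Int.emod_nonneg _ hM'.ne')
  have hmaps : ∀ n ∈ Finset.range M, ((d * n + t) % M).toNat ∈ Finset.range M := by
    intro n _
    have := hcast n
    have := Int.emod_lt_of_pos (d * n + t) hM'
    rw [Finset.mem_range]
    omega
  have hinj : Set.InjOn (fun n : ℕ => ((d * n + t) % M).toNat) (Finset.range M) := by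
    intro m hm n hn hmn
    have h₁ : (d * m + t) % M = (d * n + t) % M := by
      rw [← hcast m, ← hcast n]
      exact congrArg Nat.cast hmn
    have h₂ : (M : ℤ) ∣ d * ((n : ℤ) - m) := by
      have := Int.ModEq.dvd h₁
      rwa [show d * (n : ℤ) + t - (d * m + t) = d * ((n : ℤ) - m) by ring] at this
    have h₃ : m ≡ n [MOD M] :=
      Int.natCast_modEq_iff.mp (Int.modEq_iff_dvd.mpr (hd.symm.dvd_of_dvd_mul_left h₂))
    exact h₃.eq_of_lt_of_lt (by simpa using hm) (by simpa using hn)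
  refine Finset.sum_nbij _ hmaps hinj
    (Finset.surjOn_of_injOn_of_card_le _ hmaps hinj le_rfl) fun n _ => hf _ _ ?_
  rw [hcast]
  exact (Int.mod_modEq _ _).symm

/-- Diamond operator action on the `Γ₁(N)` Eisenstein series: for
`γ = [[a,b],[c,d]] ∈ Γ₀(N)` and `e` with `d·e ≡ 1 (mod N)`,
`E_k^{(1)}(λ, N)|_k γ = E_k^{(1)}((e·λ₁, d·λ₂), N)`. -/
theorem diamond_action_Ek1 (N k : ℕ) (hN : 3 ≤ N) (hk : 3 ≤ k)
    (lam : ℤ × ℤ) (hlam : Int.gcd lam.1 (Int.gcd lam.2 (N : ℤ)) = 1)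
    (γ : SL2Z) (hγ : γ ∈ CongruenceSubgroup.Gamma0 N)
    (e : ℤ) (he : (((γ 1 1 : ℤ) * e : ℤ) : ZMod N) = 1) :
    slashf (k : ℤ) γ (Ek1 k N lam) = Ek1 k N (e * lam.1, (γ 1 1 : ℤ) * lam.2) := by
  have hN0 : 0 < N := by omega
  have hde : (N : ℤ) ∣ γ 1 1 * e - 1 := by
    rw [← ZMod.intCast_zmod_eq_zero_iff_dvd]
    push_cast at he ⊢
    rw [he, sub_self]
  obtain ⟨q, hq⟩ := hde
  have hc : ((γ 1 0 : ℤ) : ZMod N) = 0 := CongruenceSubgroup.Gamma0_mem.mp hγ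
  have hdet := congrArg (Int.cast : ℤ → ZMod N) γ.det_coe
  rw [Matrix.det_fin_two] at hdet
  push_cast at hdet he
  have ha : ((γ 0 0 : ℤ) : ZMod N) = e := by
    linear_combination (e : ZMod N) * hdet - (γ 0 0 : ZMod N) * he +
      (e : ZMod N) * (γ 0 1 : ZMod N) * hc
  have hdN : IsCoprime (γ 1 1) (N : ℤ) := ⟨e, -q, by linear_combination hq⟩
  have heN : IsCoprime e (N : ℤ) := ⟨γ 1 1, -q, by linear_combination hq⟩
  have hgcd : Int.gcd (e * lam.1) N = Int.gcd lam.1 N :=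
    Int.gcd_mul_right_left_of_gcd_eq_one (Int.isCoprime_iff_gcd_eq_one.mp heN)
  funext τ
  simp only [Ek1, hgcd]
  set δ := Int.gcd lam.1 N with hδ
  have hδN : δ ∣ N := by exact_mod_cast Int.gcd_dvd_right lam.1 (N : ℤ)
  obtain ⟨M, hM⟩ := hδN
  have hδ0 : 0 < δ := Nat.pos_of_ne_zero fun h => by simp [h] at hM; omega
  have hM0 : 0 < M := Nat.pos_of_ne_zero fun h => by simp [h] at hM; omega
  have hdiv : N / δ = M := by rw [hM, Nat.mul_div_cancel_left _ hδ0]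
  obtain ⟨t, ht⟩ : (δ : ℤ) ∣ lam.1 := Int.gcd_dvd_left lam.1 (N : ℤ)
  have hdM : IsCoprime (γ 1 1) (M : ℤ) :=
    hdN.of_isCoprime_of_dvd_right ⟨δ, by rw [hM]; push_cast; ring⟩
  rw [hdiv, ← sum_range_affine_of_periodic hM0 (f := fun n : ℤ =>
    Ek k N (((e * lam.1 : ℤ) : ZMod N), ((γ 1 1 * lam.2 + δ * n : ℤ) : ZMod N)) τ)
    ?_ hdM (γ 0 1 * t)]
  · simp only [slashf, Ek1, ← hδ, hdiv]
    rw [Finset.mul_sum]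
    refine Finset.sum_congr rfl fun n _ => ?_
    refine (congrFun (slashf_Ek k N γ (lam.1, lam.2 + δ * n)) τ).trans ?_
    refine congrArg (fun w => Ek k N w τ) ?_
    simp only [rowMulEquiv, Equiv.coe_fn_mk]
    rw [Prod.mk.injEq]
    constructor
    · push_cast
      rw [hc, ha]
      ring
    · congr 1
      linear_combination (γ 0 1) * ht
  · intro x y hxy
    have h : ((γ 1 1 * lam.2 + δ * x : ℤ) : ZMod N) = ((γ 1 1 * lam.2 + δ * y : ℤ) : ZMod N) := by
      rw [ZMod.intCast_eq_intCast_iff, hM]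
      push_cast
      exact (Int.ModEq.mul_left' hxy).add_left _
    simp only [h]
end
end
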